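/- arXiv:1703.07293 — 3 statements merged into one kernel-verified Lean document; each statement's English description precedes it below -/
import Mathlib

section
/- Let v : R^2 → R^2 be a bounded continuous vector field with |v(x)| ≥ η > 0 for all x, and let γ : R → R^2 solve γ'(t) = v(γ(t)). If u : R^2 → R is a C^1 stream function for v (i.e., ∇u = (-v2, v1)) and γ is one-to-one, then any streamline of v (the image of γ) is unbounded: |γ(t)| → +∞ as |t| → +∞ is implied whenever no point of the plane is an accumulation point of {γ(t_n)} for |t_n| → ∞. More precisely: if v is a C^1 bounded vector field on R^2 with inf |v| > 0 and u is a stream function of v, then for every x ∈ R^2 the solution γ_x of γ'(t) = v(γ(t)), γ(0) = x satisfies |γ_x(t)| → +∞ as |t| → +∞. -/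
open Real Set Filter MeasureTheory

noncomputable section

/-- The Euclidean plane. -/
abbrev V2 : Type := EuclideanSpace ℝ (Fin 2)

/-- Build a point of the plane from two coordinates. -/
def mk2 (a b : ℝ) : V2 := (WithLp.equiv 2 (Fin 2 → ℝ)).symm ![a, b]

/-- Partial derivative of a scalar function in direction `i`. -/
def pd (i : Fin 2) (f : V2 → ℝ) (x : V2) : ℝ := fderiv ℝ f x (EuclideanSpace.single i 1)

/-- Partial derivative of a vector field in direction `i`. -/
def pdv (i : Fin 2) (v : V2 → V2) (x : V2) : V2 := fderiv ℝ v x (EuclideanSpace.single i 1)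

/-- The steady incompressible Euler equations `v·∇v + ∇p = 0`, `div v = 0` in the plane. -/
def IsEuler (v : V2 → V2) (p : V2 → ℝ) : Prop :=
  (∀ x, (v x 0) • pdv 0 v x + (v x 1) • pdv 1 v x + gradient p x = 0) ∧
  (∀ x, pdv 0 v x 0 + pdv 1 v x 1 = 0)

/-- The line through two points of the plane. -/
def lineThrough (x y : V2) : Set V2 := {z | ∃ t : ℝ, z = x + t • (y - x)}


theorem exp_lift_unique {X : Type*} [TopologicalSpace X] [PreconnectedSpace X] {F G : X → ℂ}
    (hF : Continuous F) (hG : Continuous G) (h : ∀ x, Complex.exp (F x) = Complex.exp (G x))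
    (a : X) (ha : F a = G a) : F = G :=
  Complex.isCoveringMap_exp.eq_of_comp_eq hF hG
    (by funext x; exact Subtype.ext (h x)) a ha

theorem exp_lift_exists {X : Type*} [TopologicalSpace X] [ContractibleSpace X]
    [LocallyPathConnectedSpace X] (g : X → ℂ) (hg : Continuous g) (h0 : ∀ x, g x ≠ 0) :
    ∃ F : X → ℂ, Continuous F ∧ ∀ x, Complex.exp (F x) = g x := by
  obtain ⟨x₀⟩ : Nonempty X := inferInstance
  obtain ⟨F, ⟨-, hF⟩, -⟩ := Complex.isCoveringMapOn_exp.existsUnique_continuousMap_lifts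
    (⟨g, hg⟩ : C(X, ℂ)) (a₀ := x₀) (e₀ := Complex.log (g x₀)) (Complex.exp_log (h0 x₀))
    (fun x => h0 x)
  exact ⟨F, F.continuous, fun x => congrFun hF x⟩

/-- Hopf-type argument: a simple closed curve whose velocity has a periodic logarithm is
impossible. -/
theorem no_periodic_log (z V L : ℝ → ℂ) (T : ℝ) (hT : 0 < T)
    (hz : ∀ t, HasDerivAt z (V t) t) (hV : Continuous V)
    (hzT : ∀ t, z (t + T) = z t) (hVT : ∀ t, V (t + T) = V t)
    (hinj : ∀ s d, 0 < d → d < T → z (s + d) ≠ z s)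
    (hL : Continuous L) (hLV : ∀ t, Complex.exp (L t) = V t) (hLT : L T = L 0) : False := by
  set c : ℝ → ℝ := fun d => max 0 (min d (T / 2)) with hc
  have hcc : Continuous c := by fun_prop
  set H : ℝ × ℝ → ℂ := fun p => ∫ l in (0:ℝ)..1, V (p.1 + l * c p.2) with hH
  have hHc : Continuous H := by
    apply intervalIntegral.continuous_parametric_intervalIntegral_of_continuous'
    fun_prop
  have hint : ∀ s d : ℝ, (d : ℂ) * (∫ l in (0:ℝ)..1, V (s + l * d)) = z (s + d) - z s := by
    intro s d
    have h1 : ∀ l ∈ Set.uIcc (0:ℝ) 1,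
        HasDerivAt (fun l : ℝ => z (s + l * d)) (d • V (s + l * d)) l := by
      intro l _
      have : HasDerivAt (fun l : ℝ => s + l * d) d l := by
        simpa using ((hasDerivAt_id l).mul_const d).const_add s
      exact (hz (s + l * d)).scomp l this
    have h2 := intervalIntegral.integral_eq_sub_of_hasDerivAt h1
      (Continuous.intervalIntegrable (by fun_prop) _ _)
    simp only [one_mul, zero_mul, add_zero] at h2
    rw [← h2, intervalIntegral.integral_smul]
    simp
  have hVne : ∀ t, V t ≠ 0 := fun t => by rw [← hLV]; exact Complex.exp_ne_zero _
  have hHne : ∀ p, H p ≠ 0 := by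
    rintro ⟨s, d⟩
    have hc0 : 0 ≤ c d := le_max_left _ _
    have hc1 : c d < T := by
      refine lt_of_le_of_lt (max_le (by positivity) (min_le_right _ _)) (by linarith : T / 2 < T)
    rcases hc0.eq_or_lt with h | h
    · simp only [hH, ← h]
      simpa using hVne s
    · intro h3
      have := hint s (c d)
      simp only [hH] at h3
      rw [h3, mul_zero] at this
      exact hinj s (c d) h hc1 (sub_eq_zero.1 this.symm)
  obtain ⟨Θ, hΘ, hΘe⟩ := exp_lift_exists H hHc hHne
  have hH0 : ∀ s, H (s, 0) = V s := by
    intro s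
    have : c 0 = 0 := by
      simp only [hc]
      rw [min_eq_left (by positivity)]; simp
    simp [hH, this]
  have hHT : ∀ s d, H (s + T, d) = H (s, d) := by
    intro s d
    simp only [hH]
    congr 1; funext l
    rw [← hVT (s + l * c d)]; congr 1; ring
  have e1 : (fun s => Θ (s, 0)) = fun s => L s + (Θ (0, 0) - L 0) := by
    refine exp_lift_unique (by fun_prop) (by fun_prop) (fun s => ?_) 0 (by ring)
    rw [hΘe, hH0, Complex.exp_add, Complex.exp_sub, hΘe, hH0, hLV, hLV, div_self (hVne 0), mul_one]
  have e2 : (fun p : ℝ × ℝ => Θ (p.1 + T, p.2)) = Θ := by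
    refine exp_lift_unique (by fun_prop) hΘ (fun p => ?_) (0, 0) ?_
    · rw [hΘe, hΘe, hHT]
    · have := congrFun e1 T
      simp only [hLT] at this
      simp only [zero_add, this]
      ring
  have hHh : ∀ s, H (s + T / 2, T / 2) = - H (s, T / 2) := by
    intro s
    have hcT : c (T / 2) = T / 2 := by
      simp only [hc]
      rw [min_self, max_eq_right (by positivity)]
    simp only [hH, hcT]
    have hne : ((T / 2 : ℝ) : ℂ) ≠ 0 := by
      exact_mod_cast (by positivity : T / 2 ≠ 0)
    apply mul_left_cancel₀ hne
    rw [mul_neg, hint, hint, add_assoc, add_halves, hzT]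
    ring
  set E := Θ (T / 2, T / 2) - Θ (0, T / 2) with hE
  have hEe : Complex.exp E = -1 := by
    have := hHh 0
    rw [zero_add] at this
    rw [hE, Complex.exp_sub, hΘe, hΘe, this, neg_div, div_self (hHne _)]
  have e3 : (fun s => Θ (s + T / 2, T / 2)) = fun s => Θ (s, T / 2) + E := by
    refine exp_lift_unique (by fun_prop) (by fun_prop) (fun s => ?_) 0 (by rw [hE, zero_add]; ring)
    rw [hΘe, hHh, Complex.exp_add, hEe, hΘe]; ring
  have h1 := congrFun e3 (T / 2)
  have h2 := congrFun e2 (0, T / 2)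
  simp only [add_halves, zero_add] at h1 h2
  have hE0 : E = 0 := by
    rw [h2] at h1
    have : E + E = 0 := by
      linear_combination hE - h1
    simpa using this
  rw [hE0, Complex.exp_zero] at hEe
  norm_num at hEe

theorem periodic_of_return (v : V2 → V2) (hv : ContDiff ℝ 1 v) (γ : ℝ → V2)
    (hγ : ∀ t, HasDerivAt γ (v (γ t)) t) {a b : ℝ} (h : γ a = γ b) :
    Function.Periodic γ (a - b) := by
  have h1 : IsMIntegralCurve (I := modelWithCornersSelf ℝ V2) γ v := by
    intro t
    exact (hγ t).hasFDerivAt.hasMFDerivAt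
  exact h1.periodic_of_eq (contMDiff_vectorSpace_iff_contDiff.2 hv) h

theorem exists_min_period (v : V2 → V2) (hv : ContDiff ℝ 1 v) (hv0 : ∀ x, v x ≠ 0) (γ : ℝ → V2)
    (hγ : ∀ t, HasDerivAt γ (v (γ t)) t) {a b : ℝ} (hab : a ≠ b) (h : γ a = γ b) :
    ∃ T, 0 < T ∧ Function.Periodic γ T ∧ ∀ s d, 0 < d → d < T → γ (s + d) ≠ γ s := by
  have hγc : Continuous γ := continuous_iff_continuousAt.2 fun t => (hγ t).continuousAt
  have hne : ∀ᶠ t in nhdsWithin 0 {(0:ℝ)}ᶜ, γ t ≠ γ 0 := (hγ 0).eventually_ne (hv0 _)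
  rw [eventually_nhdsWithin_iff, Metric.eventually_nhds_iff] at hne
  obtain ⟨ε, hε, hne⟩ := hne
  set P : Set ℝ := {T | ε ≤ T} ∩ {T | Function.Periodic γ T} with hP
  have hmem : ∀ T, 0 < T → Function.Periodic γ T → T ∈ P := by
    intro T hT hper
    refine ⟨?_, hper⟩
    by_contra hlt
    simp only [mem_ofPred_eq, not_le] at hlt
    refine hne (y := T) ?_ hT.ne' (by simpa using hper 0)
    rw [Real.dist_eq, sub_zero, abs_of_pos hT]; exact hlt
  have hcl : IsClosed P := by
    refine (isClosed_le continuous_const continuous_id).inter ?_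
    have : {T | Function.Periodic γ T} = ⋂ t, {T | γ (t + T) = γ t} := by
      ext T; simp [Function.Periodic]
    rw [this]
    exact isClosed_iInter fun t => isClosed_eq (by fun_prop) continuous_const
  have hbdd : BddBelow P := ⟨ε, fun T hT => hT.1⟩
  have hnon : P.Nonempty := by
    rcases lt_or_gt_of_ne hab with hlt | hlt
    · exact ⟨b - a, hmem _ (by linarith) (periodic_of_return v hv γ hγ h.symm)⟩
    · exact ⟨a - b, hmem _ (by linarith) (periodic_of_return v hv γ hγ h)⟩
  have hin := hcl.csInf_mem hnon hbdd
  refine ⟨sInf P, lt_of_lt_of_le hε hin.1, hin.2, fun s d hd hdT heq => ?_⟩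
  have h2 := periodic_of_return v hv γ hγ heq
  rw [add_sub_cancel_left] at h2
  exact absurd (csInf_le hbdd (hmem d hd h2)) (not_le.2 hdT)

/-- The linear identification of the plane with the complex numbers. -/
def toC : V2 →L[ℝ] ℂ :=
  (EuclideanSpace.proj (0 : Fin 2) : V2 →L[ℝ] ℝ).smulRight (1 : ℂ) +
    (EuclideanSpace.proj (1 : Fin 2) : V2 →L[ℝ] ℝ).smulRight Complex.I

theorem toC_inj : Function.Injective toC := by
  intro x y h
  have h0 := congrArg Complex.re h
  have h1 := congrArg Complex.im h
  simp [toC] at h0 h1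
  ext i
  fin_cases i
  · exact h0
  · exact h1

theorem orbit_injective (v : V2 → V2) (hv : ContDiff ℝ 1 v) (hv0 : ∀ x, v x ≠ 0) (γ : ℝ → V2)
    (hγ : ∀ t, HasDerivAt γ (v (γ t)) t) : Function.Injective γ := by
  intro a b h
  by_contra hab
  obtain ⟨T, hT, hper, hinj⟩ := exists_min_period v hv hv0 γ hγ hab h
  have hγc : Continuous γ := continuous_iff_continuousAt.2 fun t => (hγ t).continuousAt
  have hvc := hv.continuous
  obtain ⟨g, hg, hge⟩ := exp_lift_exists (fun x => toC (v x)) (toC.continuous.comp hvc)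
    (fun x hx => hv0 x (toC_inj (by simpa using hx)))
  refine no_periodic_log (fun t => toC (γ t)) (fun t => toC (v (γ t))) (fun t => g (γ t)) T hT
    (fun t => toC.hasFDerivAt.comp_hasDerivAt t (hγ t)) (by fun_prop)
    (fun t => by rw [hper t]) (fun t => by simp only [hper t])
    (fun s d h1 h2 h3 => hinj s d h1 h2 (toC_inj h3)) (by fun_prop) (fun t => hge _) ?_
  have := hper 0
  rw [zero_add] at this
  simp only [this]

theorem stream_fderiv (v : V2 → V2) (u : V2 → ℝ)
    (hstream : ∀ x, pd 0 u x = v x 1 ∧ pd 1 u x = -(v x 0)) (x w : V2) :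
    fderiv ℝ u x w = v x 1 * w 0 - v x 0 * w 1 := by
  have hw : w = w 0 • EuclideanSpace.single (0 : Fin 2) (1:ℝ) +
      w 1 • EuclideanSpace.single (1 : Fin 2) (1:ℝ) := by
    ext i; fin_cases i <;> simp
  obtain ⟨h1, h2⟩ := hstream x
  unfold pd at h1 h2
  conv_lhs => rw [hw]
  rw [map_add, map_smul, map_smul, h1, h2]
  simp only [smul_eq_mul]; ring

theorem stream_const (v : V2 → V2) (u : V2 → ℝ) (hu : ContDiff ℝ 2 u)
    (hstream : ∀ x, pd 0 u x = v x 1 ∧ pd 1 u x = -(v x 0)) (γ : ℝ → V2)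
    (hγ : ∀ t, HasDerivAt γ (v (γ t)) t) (s t : ℝ) : u (γ s) = u (γ t) := by
  have hd : ∀ t, HasDerivAt (fun t => u (γ t)) 0 t := by
    intro t
    have := ((hu.differentiable (by norm_num)) (γ t)).hasFDerivAt.comp_hasDerivAt t (hγ t)
    rw [stream_fderiv v u hstream] at this
    rw [show v (γ t) 1 * v (γ t) 0 - v (γ t) 0 * v (γ t) 1 = 0 by ring] at this
    exact this
  exact is_const_of_deriv_eq_zero (fun t => (hd t).differentiableAt) (fun t => (hd t).deriv) s t

/-- Near any point, two points on the streamline `γ` are connected by a short piece of `γ`. -/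
theorem local_box (v : V2 → V2) (hv : ContDiff ℝ 1 v) (C : ℝ) (hb : ∀ x, ‖v x‖ ≤ C)
    (hv0 : ∀ x, v x ≠ 0) (u : V2 → ℝ) (hu : ContDiff ℝ 2 u)
    (hstream : ∀ x, pd 0 u x = v x 1 ∧ pd 1 u x = -(v x 0)) (γ : ℝ → V2)
    (hγ : ∀ t, HasDerivAt γ (v (γ t)) t) (y : V2) :
    ∃ ε > 0, ∃ δ > 0, ∀ t₁ t₂, γ t₁ ∈ Metric.ball y ε → γ t₂ ∈ Metric.ball y ε →
      ∃ s, |s| ≤ δ ∧ γ (t₁ + s) = γ t₂ := by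
  have hvc := hv.continuous
  have hC : 0 < C := lt_of_lt_of_le (norm_pos_iff.2 (hv0 y)) (hb y)
  have hγc : Continuous γ := continuous_iff_continuousAt.2 fun t => (hγ t).continuousAt
  set a := v y with ha
  set m : ℝ := (‖a‖ ^ 2) / 2 with hm
  have ha0 : 0 < ‖a‖ := norm_pos_iff.2 (hv0 y)
  have hm0 : 0 < m := by positivity
  have hev : ∀ᶠ x in nhds y, m < inner ℝ a (v x) := by
    have hc : Continuous fun x => inner ℝ a (v x) := by fun_prop
    refine hc.continuousAt.eventually (lt_mem_nhds ?_)
    show m < inner ℝ a a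
    rw [real_inner_self_eq_norm_sq]
    linarith
  obtain ⟨ρ, hρ, hball⟩ := Metric.eventually_nhds_iff_ball.1 hev
  set δ := ρ / (2 * C) with hδ
  have hδ0 : 0 < δ := by positivity
  have hCδ : C * δ = ρ / 2 := by rw [hδ]; field_simp
  set ε := min (ρ / 2) (δ * m / (2 * ‖a‖)) with hε
  have hε0 : 0 < ε := by positivity
  refine ⟨ε, hε0, δ, hδ0, fun t₁ t₂ h1 h2 => ?_⟩
  rw [Metric.mem_ball] at h1 h2
  have hερ : ε ≤ ρ / 2 := min_le_left _ _
  have hεm : ε * (2 * ‖a‖) ≤ δ * m := by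
    rw [← le_div_iff₀ (by positivity)]; exact min_le_right _ _
  have hstay : ∀ s ∈ Icc (-δ) δ, γ (t₁ + s) ∈ Metric.ball y ρ := by
    intro s hs
    have hlip := Convex.norm_image_sub_le_of_norm_hasDerivWithin_le (f := γ) (C := C)
      (s := univ) (fun t _ => (hγ t).hasDerivWithinAt) (fun t _ => hb _) convex_univ
      (mem_univ t₁) (mem_univ (t₁ + s))
    rw [add_sub_cancel_left, Real.norm_eq_abs, ← dist_eq_norm] at hlip
    have : C * |s| ≤ C * δ := by gcongr; exact abs_le.2 hs
    rw [Metric.mem_ball]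
    have := dist_triangle (γ (t₁ + s)) (γ t₁) y
    linarith
  set f : ℝ → ℝ := fun s => inner ℝ a (γ (t₁ + s)) with hf
  have hfd : ∀ s, HasDerivAt f (inner ℝ a (v (γ (t₁ + s)))) s := by
    intro s
    have h3 : HasDerivAt (fun s => γ (t₁ + s)) (v (γ (t₁ + s))) s := by
      exact (hγ (t₁ + s)).comp_const_add t₁ s
    exact (innerSL ℝ a).hasFDerivAt.comp_hasDerivAt s h3
  have hfc : Continuous f := by fun_prop
  have hgrow : ∀ p ∈ Icc (-δ) δ, ∀ q ∈ Icc (-δ) δ, p ≤ q → m * (q - p) ≤ f q - f p := by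
    refine Convex.mul_sub_le_image_sub_of_le_deriv (convex_Icc _ _) hfc.continuousOn
      (fun s _ => (hfd s).differentiableAt.differentiableWithinAt) (fun s hs => ?_)
    rw [(hfd s).deriv]
    exact (hball _ (hstay s (interior_subset hs))).le
  have g1 := hgrow 0 ⟨by linarith, hδ0.le⟩ δ ⟨by linarith, le_rfl⟩ hδ0.le
  have g2 := hgrow (-δ) ⟨le_rfl, by linarith⟩ 0 ⟨by linarith, hδ0.le⟩ (by linarith)
  have hq : |inner ℝ a (γ t₂) - f 0| ≤ δ * m := by
    simp only [hf, add_zero]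
    rw [← inner_sub_right]
    refine (abs_real_inner_le_norm _ _).trans ?_
    have : ‖γ t₂ - γ t₁‖ ≤ 2 * ε := by
      rw [← dist_eq_norm]
      have := dist_triangle_right (γ t₂) (γ t₁) y
      linarith
    calc ‖a‖ * ‖γ t₂ - γ t₁‖ ≤ ‖a‖ * (2 * ε) := by gcongr
      _ = ε * (2 * ‖a‖) := by ring
      _ ≤ _ := hεm
  rw [abs_le] at hq
  obtain ⟨s, hs, hfs⟩ := intermediate_value_Icc (by linarith : -δ ≤ δ) hfc.continuousOn
    (show inner ℝ a (γ t₂) ∈ Icc (f (-δ)) (f δ) from ⟨by linarith, by linarith⟩)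
  refine ⟨s, abs_le.2 hs, ?_⟩
  by_contra hne
  -- mean value theorem on the segment
  have hp := hstay s hs
  have hq2 : γ t₂ ∈ Metric.ball y ρ := by rw [Metric.mem_ball]; linarith
  obtain ⟨ξ, hξ, hmv⟩ := domain_mvt (f := u) (s := Metric.ball y ρ)
    (f' := fun x => fderiv ℝ u x)
    (fun x _ => ((hu.differentiable (by norm_num)) x).hasFDerivAt.hasFDerivWithinAt)
    (convex_ball y ρ) hq2 hp
  have hξb : ξ ∈ Metric.ball y ρ := (convex_ball y ρ).segment_subset hq2 hp hξ
  rw [stream_const v u hu hstream γ hγ (t₁ + s) t₂, sub_self, stream_fderiv v u hstream] at hmv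
  have hpos := hm0.trans (hball ξ hξb)
  set w := γ (t₁ + s) - γ t₂ with hw
  have hperp : inner ℝ a w = 0 := by
    rw [hw, inner_sub_right]; simp only [hf] at hfs; rw [hfs, sub_self]
  simp only [PiLp.inner_apply, Fin.sum_univ_two, RCLike.inner_apply, conj_trivial] at hpos hperp
  have hw0 : w 0 = 0 := by
    have : (v ξ 0 * a 0 + v ξ 1 * a 1) * w 0 = 0 := by
      linear_combination (v ξ 0) * hperp - (a 1) * hmv
    exact (mul_eq_zero.1 this).resolve_left hpos.ne'
  have hw1 : w 1 = 0 := by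
    have : (v ξ 0 * a 0 + v ξ 1 * a 1) * w 1 = 0 := by
      linear_combination (v ξ 1) * hperp + (a 0) * hmv
    exact (mul_eq_zero.1 this).resolve_left hpos.ne'
  apply hne
  rw [← sub_eq_zero, ← hw]
  ext i; fin_cases i
  · exact hw0
  · exact hw1

theorem stmt_6 (v : V2 → V2) (hv : ContDiff ℝ 1 v) (C : ℝ) (hb : ∀ x, ‖v x‖ ≤ C)
    (η : ℝ) (hη : 0 < η) (hlow : ∀ x, η ≤ ‖v x‖)
    (u : V2 → ℝ) (hu : ContDiff ℝ 2 u)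
    (hstream : ∀ x, pd 0 u x = v x 1 ∧ pd 1 u x = -(v x 0))
    (x : V2) (γ : ℝ → V2) (hγ : ∀ t, HasDerivAt γ (v (γ t)) t) (h0 : γ 0 = x) :
    Tendsto (fun t => ‖γ t‖) (atBot ⊔ atTop) atTop := by
  have hv0 : ∀ x, v x ≠ 0 := fun x => norm_pos_iff.1 (hη.trans_le (hlow x))
  have hinj := orbit_injective v hv hv0 γ hγ
  rw [tendsto_atTop]
  intro R
  by_contra hcon
  have hfr : ∃ᶠ t in (atBot ⊔ atTop : Filter ℝ), γ t ∈ Metric.closedBall (0 : V2) R := by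
    refine (not_eventually.1 hcon).mono fun t ht => ?_
    rw [mem_closedBall_zero_iff]
    exact (not_le.1 ht).le
  obtain ⟨y, -, hy⟩ := (isCompact_closedBall (0 : V2) R).exists_mapClusterPt_of_frequently hfr
  obtain ⟨ε, hε, δ, hδ, hbox⟩ := local_box v hv C hb hv0 u hu hstream γ hγ y
  have hfr2 : ∃ᶠ t in (atBot ⊔ atTop : Filter ℝ), γ t ∈ Metric.ball y ε :=
    hy.frequently (Metric.ball_mem_nhds y hε)
  obtain ⟨t₁, h1⟩ := hfr2.exists
  have hfar : ∀ᶠ t in (atBot ⊔ atTop : Filter ℝ), δ < |t - t₁| := by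
    rw [eventually_sup]
    constructor
    · filter_upwards [eventually_lt_atBot (t₁ - δ)] with t ht
      rw [lt_abs]; right; linarith
    · filter_upwards [eventually_gt_atTop (t₁ + δ)] with t ht
      rw [lt_abs]; left; linarith
  obtain ⟨t₂, h2, h3⟩ := (hfr2.and_eventually hfar).exists
  obtain ⟨s, hs, heq⟩ := hbox t₁ t₂ h1 h2
  have := hinj heq
  rw [← this, add_sub_cancel_left] at h3
  linarith
end
end

section
/- Let ξ : R → R^2 be a C^1 embedding (injective with ξ'(t) ≠ 0 for all t) and θ : R → R a continuous argument of ξ', i.e., ξ'(t)/|ξ'(t)| = (cos θ(t), sin θ(t)). Let a < b and suppose the arc ξ([a,b]) is non-intersecting, meaning either ξ([a,b]) ∩ (ξ(a), ξ(b)) = ∅ or ξ([a,b]) ∩ (L \ [ξ(a), ξ(b)]) = ∅, where L is the line through ξ(a) and ξ(b) and (ξ(a), ξ(b)) denotes the open segment. Then |θ(a) - θ(b)| ≤ 4π. -/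
open Real Set Filter MeasureTheory

noncomputable section

/-- A continuous function avoiding `c + 2πℤ` on an open interval is trapped. -/
lemma trap (f : ℝ → ℝ) (hf : Continuous f) (a b c : ℝ) (hab : a < b)
    (h : ∀ t ∈ Ioo a b, ∀ n : ℤ, f t ≠ c + 2 * π * n) :
    ∃ k : ℤ, (∀ t ∈ Ioo a b, c + 2 * π * k < f t ∧ f t < c + 2 * π * k + 2 * π) ∧
      (∀ t ∈ Icc a b, c + 2 * π * k ≤ f t ∧ f t ≤ c + 2 * π * k + 2 * π) := by
  have hpi := Real.pi_pos
  set m := (a + b) / 2 with hm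
  have hmI : m ∈ Ioo a b := ⟨by linarith, by linarith⟩
  set k : ℤ := ⌊(f m - c) / (2 * π)⌋ with hk
  have h1 : c + 2 * π * k ≤ f m := by
    have := Int.floor_le ((f m - c) / (2 * π))
    rw [le_div_iff₀ (by positivity)] at this
    linarith
  have h2 : f m < c + 2 * π * k + 2 * π := by
    have := Int.lt_floor_add_one ((f m - c) / (2 * π))
    rw [div_lt_iff₀ (by positivity)] at this
    linarith
  have hpc : IsPreconnected (f '' Ioo a b) := isPreconnected_Ioo.image f hf.continuousOn
  have hoc := hpc.ordConnected
  have key : ∀ t ∈ Ioo a b, c + 2 * π * k < f t ∧ f t < c + 2 * π * k + 2 * π := by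
    intro t ht
    constructor
    · by_contra hcon
      push Not at hcon
      obtain ⟨u, hu, hue⟩ := hoc.out (mem_image_of_mem f ht) (mem_image_of_mem f hmI) ⟨hcon, h1⟩
      exact h u hu k hue
    · by_contra hcon
      push Not at hcon
      obtain ⟨u, hu, hue⟩ := hoc.out (mem_image_of_mem f hmI) (mem_image_of_mem f ht)
        ⟨h2.le, hcon⟩
      refine h u hu (k + 1) ?_
      rw [hue]; push_cast; ring
  refine ⟨k, key, ?_⟩
  have hcl : IsClosed (f ⁻¹' Icc (c + 2 * π * k) (c + 2 * π * k + 2 * π)) :=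
    isClosed_Icc.preimage hf
  have hsub : closure (Ioo a b) ⊆ f ⁻¹' Icc (c + 2 * π * k) (c + 2 * π * k + 2 * π) :=
    closure_minimal (fun t ht => ⟨(key t ht).1.le, (key t ht).2.le⟩) hcl
  rw [closure_Ioo hab.ne] at hsub
  exact fun t ht => hsub ht

lemma half_plane (f : ℝ → ℝ) (hf : Continuous f) (a b φ : ℝ) (hab : a < b)
    (h : ∀ t ∈ Ioo a b, 0 ≤ Real.sin (f t - φ)) : |f a - f b| ≤ π := by
  have hpi := Real.pi_pos
  have hcl : IsClosed {t | 0 ≤ Real.sin (f t - φ)} :=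
    isClosed_le continuous_const (by fun_prop)
  have hsub : closure (Ioo a b) ⊆ {t | 0 ≤ Real.sin (f t - φ)} := closure_minimal h hcl
  rw [closure_Ioo hab.ne] at hsub
  obtain ⟨k, -, hk⟩ := trap f hf a b (φ - π / 2) hab (by
    intro t ht n hn
    have := h t ht
    rw [hn, show φ - π / 2 + 2 * π * n - φ = -(π / 2) + n * (2 * π) by ring,
      Real.sin_add_int_mul_two_pi, Real.sin_neg, Real.sin_pi_div_two] at this
    linarith)
  have key : ∀ t ∈ Icc a b, φ + 2 * π * k ≤ f t ∧ f t ≤ φ + 2 * π * k + π := by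
    intro t ht
    have hs : 0 ≤ Real.sin (f t - φ) := hsub ht
    obtain ⟨h1, h2⟩ := hk t ht
    rw [show f t - φ = (f t - φ - 2 * π * k) + k * (2 * π) by ring,
      Real.sin_add_int_mul_two_pi] at hs
    constructor
    · by_contra hcon
      push Not at hcon
      have := Real.sin_neg_of_neg_of_neg_pi_lt (x := f t - φ - 2 * π * k) (by linarith)
        (by linarith)
      linarith
    · by_contra hcon
      push Not at hcon
      have := Real.sin_pos_of_pos_of_lt_pi (x := f t - φ - 2 * π * k - π) (by linarith)
        (by linarith)
      rw [Real.sin_sub_pi] at this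
      linarith
  obtain ⟨h1, h2⟩ := key a ⟨le_refl _, hab.le⟩
  obtain ⟨h3, h4⟩ := key b ⟨hab.le, le_refl _⟩
  rw [abs_le]
  constructor <;> linarith

lemma const_of_cos (f : ℝ → ℝ) (hf : Continuous f) (h : ∀ t, Real.cos (f t) = 1) (a b : ℝ)
    (hab : a < b) : f a = f b := by
  have hpi := Real.pi_pos
  obtain ⟨k, -, hk⟩ := trap f hf a b π hab (by
    intro t ht n hn
    have := h t
    rw [hn, show π + 2 * π * n = π + n * (2 * π) by ring,
      Real.cos_add_int_mul_two_pi, Real.cos_pi] at this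
    linarith)
  have key : ∀ t ∈ Icc a b, f t = 2 * π * k + 2 * π := by
    intro t ht
    obtain ⟨h1, h2⟩ := hk t ht
    have hc := h t
    rw [show f t = (f t - 2 * π * k - 2 * π) + ((k + 1 : ℤ) : ℝ) * (2 * π) by push_cast; ring,
      Real.cos_add_int_mul_two_pi, Real.cos_eq_one_iff_of_lt_of_lt (by linarith) (by linarith)]
      at hc
    linarith
  rw [key a ⟨le_refl _, hab.le⟩, key b ⟨hab.le, le_refl _⟩]

/-- Secants near a point have direction close to that of the tangent. -/
lemma secant_cone (z : ℝ → ℂ) (r θ : ℝ → ℝ) (hr : ∀ t, 0 < r t) (hθ : Continuous θ)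
    (hz : ∀ t, HasDerivAt z (r t * Complex.exp (θ t * Complex.I)) t) (t₀ ε : ℝ) (hε : 0 < ε) :
    ∃ δ > 0, ∀ s ∈ Metric.ball t₀ δ, ∀ t ∈ Metric.ball t₀ δ, s < t →
      |((z t - z s) * Complex.exp (-θ t₀ * Complex.I)).im| ≤
        ε * ((z t - z s) * Complex.exp (-θ t₀ * Complex.I)).re := by
  have hW : ∀ t, HasDerivAt (fun t => z t * Complex.exp (-θ t₀ * Complex.I))
      (r t * Complex.exp ((θ t - θ t₀ : ℝ) * Complex.I)) t := by
    intro t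
    have := (hz t).mul_const (Complex.exp (-θ t₀ * Complex.I))
    refine this.congr_deriv ?_
    rw [mul_assoc, ← Complex.exp_add]
    congr 2
    push_cast; ring
  have hre : ∀ t, HasDerivAt (fun t => (z t * Complex.exp (-θ t₀ * Complex.I)).re)
      (r t * Real.cos (θ t - θ t₀)) t := by
    intro t
    have := Complex.reCLM.hasFDerivAt.comp_hasDerivAt t (hW t)
    refine this.congr_deriv ?_
    rw [Complex.reCLM_apply, Complex.re_ofReal_mul, Complex.exp_ofReal_mul_I_re]
  have him : ∀ t, HasDerivAt (fun t => (z t * Complex.exp (-θ t₀ * Complex.I)).im)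
      (r t * Real.sin (θ t - θ t₀)) t := by
    intro t
    have := Complex.imCLM.hasFDerivAt.comp_hasDerivAt t (hW t)
    refine this.congr_deriv ?_
    rw [Complex.imCLM_apply, Complex.im_ofReal_mul, Complex.exp_ofReal_mul_I_im]
  have hn1 : ∀ᶠ t in nhds t₀, 0 < ε * Real.cos (θ t - θ t₀) - Real.sin (θ t - θ t₀) := by
    have hc : Continuous fun t => ε * Real.cos (θ t - θ t₀) - Real.sin (θ t - θ t₀) := by fun_prop
    refine hc.continuousAt.eventually_const_lt ?_
    simpa using hε
  have hn2 : ∀ᶠ t in nhds t₀, 0 < ε * Real.cos (θ t - θ t₀) + Real.sin (θ t - θ t₀) := by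
    have hc : Continuous fun t => ε * Real.cos (θ t - θ t₀) + Real.sin (θ t - θ t₀) := by fun_prop
    refine hc.continuousAt.eventually_const_lt ?_
    simpa using hε
  obtain ⟨δ, hδ, hball⟩ := Metric.eventually_nhds_iff_ball.1 (hn1.and hn2)
  refine ⟨δ, hδ, fun s hs t ht hst => ?_⟩
  have hsub : ∀ u ∈ Icc s t, u ∈ Metric.ball t₀ δ := by
    intro u hu
    exact (convex_ball t₀ δ).ordConnected.out hs ht hu
  have m1 : MonotoneOn (fun u => ε * (z u * Complex.exp (-θ t₀ * Complex.I)).re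
      - (z u * Complex.exp (-θ t₀ * Complex.I)).im) (Icc s t) := by
    have hd : ∀ u, HasDerivAt (fun u => ε * (z u * Complex.exp (-θ t₀ * Complex.I)).re
      - (z u * Complex.exp (-θ t₀ * Complex.I)).im)
      (ε * (r u * Real.cos (θ u - θ t₀)) - r u * Real.sin (θ u - θ t₀)) u :=
      fun u => ((hre u).const_mul ε).sub (him u)
    refine monotoneOn_of_deriv_nonneg (convex_Icc s t)
      (fun u _ => (hd u).continuousAt.continuousWithinAt)
      (fun u _ => (hd u).differentiableAt.differentiableWithinAt) ?_
    intro u hu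
    rw [(hd u).deriv]
    have := (hball u (hsub u (interior_subset hu))).1
    have := mul_pos (hr u) this
    linarith
  have m2 : MonotoneOn (fun u => ε * (z u * Complex.exp (-θ t₀ * Complex.I)).re
      + (z u * Complex.exp (-θ t₀ * Complex.I)).im) (Icc s t) := by
    have hd : ∀ u, HasDerivAt (fun u => ε * (z u * Complex.exp (-θ t₀ * Complex.I)).re
      + (z u * Complex.exp (-θ t₀ * Complex.I)).im)
      (ε * (r u * Real.cos (θ u - θ t₀)) + r u * Real.sin (θ u - θ t₀)) u :=
      fun u => ((hre u).const_mul ε).add (him u)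
    refine monotoneOn_of_deriv_nonneg (convex_Icc s t)
      (fun u _ => (hd u).continuousAt.continuousWithinAt)
      (fun u _ => (hd u).differentiableAt.differentiableWithinAt) ?_
    intro u hu
    rw [(hd u).deriv]
    have := (hball u (hsub u (interior_subset hu))).2
    have := mul_pos (hr u) this
    linarith
  have h1 := m1 (left_mem_Icc.2 hst.le) (right_mem_Icc.2 hst.le) hst.le
  have h2 := m2 (left_mem_Icc.2 hst.le) (right_mem_Icc.2 hst.le) hst.le
  simp only at h1 h2
  rw [sub_mul, Complex.sub_im, Complex.sub_re, abs_le]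
  constructor <;> linarith

lemma unit_close (g : ℂ) (hg : ‖g‖ = 1) (ε : ℝ) (hε : 0 < ε) (hε1 : ε ≤ 1)
    (h : |g.im| ≤ ε * g.re) : ‖g - 1‖ ≤ 2 * ε := by
  have hsq : g.re ^ 2 + g.im ^ 2 = 1 := by
    have := Complex.sq_norm g
    rw [hg, Complex.normSq_apply] at this
    linarith
  have hre0 : 0 ≤ g.re := by
    have := (abs_nonneg _).trans h
    exact nonneg_of_mul_nonneg_right this hε
  have hre1 : g.re ≤ 1 := by nlinarith [sq_nonneg g.im]
  have him : |g.im| ≤ ε := h.trans (by nlinarith)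
  have him2 : g.im ^ 2 ≤ ε := by
    rw [← sq_abs]; nlinarith [abs_nonneg g.im]
  have hre2 : 1 - ε ≤ g.re := by nlinarith
  have := Complex.norm_le_abs_re_add_abs_im (g - 1)
  simp only [Complex.sub_re, Complex.one_re, Complex.sub_im, Complex.one_im, sub_zero] at this
  have h3 : |g.re - 1| ≤ ε := by rw [abs_le]; constructor <;> linarith
  linarith

/-- The Hopf secant direction. -/
def secDir (z : ℝ → ℂ) (θ : ℝ → ℝ) (p : ℝ × ℝ) : ℂ :=
  if p.1 = p.2 then Complex.exp (θ p.1 * Complex.I)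
  else (z (max p.1 p.2) - z (min p.1 p.2)) / (‖z (max p.1 p.2) - z (min p.1 p.2)‖ : ℝ)

lemma secDir_norm (z : ℝ → ℂ) (θ : ℝ → ℝ) (hinj : Function.Injective z) (p : ℝ × ℝ) :
    ‖secDir z θ p‖ = 1 := by
  unfold secDir
  split_ifs with h
  · exact Complex.norm_exp_ofReal_mul_I _
  · have hne : z (max p.1 p.2) - z (min p.1 p.2) ≠ 0 := by
      rw [sub_ne_zero]
      intro hh
      exact (min_lt_max.2 h).ne (hinj hh).symm
    rw [norm_div, Complex.norm_real, norm_norm, div_self (norm_ne_zero_iff.2 hne)]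

lemma secDir_cont (z : ℝ → ℂ) (r θ : ℝ → ℝ) (hr : ∀ t, 0 < r t) (hθ : Continuous θ)
    (hz : ∀ t, HasDerivAt z (r t * Complex.exp (θ t * Complex.I)) t)
    (hinj : Function.Injective z) : Continuous (secDir z θ) := by
  have hzc : Continuous z := continuous_iff_continuousAt.2 fun t => (hz t).continuousAt
  rw [continuous_iff_continuousAt]
  rintro ⟨s₀, t₀⟩
  by_cases hst : s₀ = t₀
  · subst hst
    rw [Metric.continuousAt_iff']
    intro η hη
    set ε := min 1 (η / 4) with hεd
    have hε : 0 < ε := lt_min one_pos (by linarith)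
    have hε1 : ε ≤ 1 := min_le_left _ _
    have hε2 : ε ≤ η / 4 := min_le_right _ _
    obtain ⟨δ, hδ, hcone⟩ := secant_cone z r θ hr hθ hz s₀ ε hε
    have hec : Continuous fun t : ℝ => Complex.exp (θ t * Complex.I) := by fun_prop
    have he := Metric.continuousAt_iff'.1 (hec.continuousAt (x := s₀)) η hη
    have h1 : ∀ᶠ p : ℝ × ℝ in nhds (s₀, s₀), p.1 ∈ Metric.ball s₀ δ ∧
        dist (Complex.exp (θ p.1 * Complex.I)) (Complex.exp (θ s₀ * Complex.I)) < η :=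
      (continuous_fst.tendsto (s₀, s₀)).eventually (Filter.Eventually.and (Metric.ball_mem_nhds s₀ hδ) he)
    have h2 : ∀ᶠ p : ℝ × ℝ in nhds (s₀, s₀), p.2 ∈ Metric.ball s₀ δ :=
      (continuous_snd.tendsto (s₀, s₀)).eventually (Metric.ball_mem_nhds s₀ hδ)
    filter_upwards [h1, h2] with p hp1 hp2
    have hb : secDir z θ (s₀, s₀) = Complex.exp (θ s₀ * Complex.I) := by simp [secDir]
    rw [hb]
    by_cases hp : p.1 = p.2
    · have : secDir z θ p = Complex.exp (θ p.1 * Complex.I) := by simp [secDir, hp]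
      rw [this]
      exact hp1.2
    · have hlt : min p.1 p.2 < max p.1 p.2 := min_lt_max.2 hp
      have hmin : min p.1 p.2 ∈ Metric.ball s₀ δ := by
        rcases min_choice p.1 p.2 with h | h <;> rw [h]
        · exact hp1.1
        · exact hp2
      have hmax : max p.1 p.2 ∈ Metric.ball s₀ δ := by
        rcases max_choice p.1 p.2 with h | h <;> rw [h]
        · exact hp1.1
        · exact hp2
      have hc := hcone _ hmin _ hmax hlt
      have hnorm := secDir_norm z θ hinj p
      set D := z (max p.1 p.2) - z (min p.1 p.2) with hD
      have hD0 : D ≠ 0 := by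
        rw [hD, sub_ne_zero]
        exact fun hh => hlt.ne' (hinj hh)
      have hDn : 0 < ‖D‖ := norm_pos_iff.2 hD0
      have hsd : secDir z θ p = D / (‖D‖ : ℝ) := by simp [secDir, hp, hD]
      set E := Complex.exp (-θ s₀ * Complex.I) with hE
      have hEn : ‖E‖ = 1 := by
        have := Complex.norm_exp_ofReal_mul_I (-θ s₀)
        rwa [Complex.ofReal_neg] at this
      have hEE : Complex.exp (θ s₀ * Complex.I) * E = 1 := by
        rw [hE, ← Complex.exp_add]; simp
      have hg : secDir z θ p * E = (((‖D‖)⁻¹ : ℝ) : ℂ) * (D * E) := by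
        rw [hsd]; push_cast; field_simp
      have hgc := unit_close (secDir z θ p * E) (by rw [norm_mul, hnorm, hEn, one_mul]) ε hε hε1
        (by
          rw [hg, Complex.re_ofReal_mul, Complex.im_ofReal_mul, abs_mul,
            abs_of_pos (inv_pos.2 hDn)]
          have := mul_le_mul_of_nonneg_left hc (inv_pos.2 hDn).le
          linarith)
      rw [dist_eq_norm]
      have : ‖secDir z θ p - Complex.exp (θ s₀ * Complex.I)‖ = ‖secDir z θ p * E - 1‖ := by
        rw [← hEE, ← sub_mul, norm_mul, hEn, mul_one]
      rw [this]
      linarith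
  · have hne : z (max s₀ t₀) - z (min s₀ t₀) ≠ 0 := by
      rw [sub_ne_zero]
      intro hh
      exact (min_lt_max.2 hst).ne (hinj hh).symm
    have hev : (fun p : ℝ × ℝ => (z (max p.1 p.2) - z (min p.1 p.2)) /
        (‖z (max p.1 p.2) - z (min p.1 p.2)‖ : ℝ)) =ᶠ[nhds (s₀, t₀)] secDir z θ := by
      have ho : IsOpen {p : ℝ × ℝ | p.1 ≠ p.2} := isOpen_ne_fun continuous_fst continuous_snd
      filter_upwards [ho.mem_nhds (show (s₀, t₀) ∈ {p : ℝ × ℝ | p.1 ≠ p.2} from hst)] with p hp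
      have hp' : ¬ p.1 = p.2 := hp
      simp [secDir, hp']
    refine ContinuousAt.congr ?_ hev
    have hn : Continuous fun p : ℝ × ℝ => z (max p.1 p.2) - z (min p.1 p.2) := by fun_prop
    refine hn.continuousAt.div (Complex.continuous_ofReal.comp hn.norm).continuousAt ?_
    simpa using hne

lemma exists_lift (z : ℝ → ℂ) (r θ : ℝ → ℝ) (hr : ∀ t, 0 < r t) (hθ : Continuous θ)
    (hz : ∀ t, HasDerivAt z (r t * Complex.exp (θ t * Complex.I)) t)
    (hinj : Function.Injective z) :
    ∃ Φ : ℝ × ℝ → ℝ, Continuous Φ ∧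
      (∀ a b, a < b → θ b - θ a = Φ (b, b) - Φ (a, a)) ∧
      (∀ s t, s < t → ∃ ρ : ℝ, 0 < ρ ∧ z t - z s = ρ * Complex.exp (Φ (s, t) * Complex.I)) := by
  have hc := secDir_cont z r θ hr hθ hz hinj
  let F : C(ℝ × ℝ, Circle) :=
    ⟨fun p => ⟨secDir z θ p, mem_sphere_zero_iff_norm.2 (secDir_norm z θ hinj p)⟩,
      Continuous.subtype_mk hc _⟩
  have hF0 : Circle.exp (θ 0) = F (0, 0) := by
    apply Subtype.ext
    change (Circle.exp (θ 0) : ℂ) = secDir z θ (0, 0)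
    simp [secDir]
  obtain ⟨Φ, ⟨-, hΦ⟩, -⟩ := Circle.isCoveringMap_exp.existsUnique_continuousMap_lifts F
    (0, 0) (θ 0) hF0
  have hΦ' : ∀ p, Complex.exp (Φ p * Complex.I) = secDir z θ p := by
    intro p
    have := congrArg (fun c : Circle => (c : ℂ)) (congrFun hΦ p)
    change (Circle.exp (Φ p) : ℂ) = secDir z θ p at this
    rwa [Circle.coe_exp] at this
  refine ⟨Φ, Φ.continuous, ?_, ?_⟩
  · intro a b hab
    have := const_of_cos (fun t => Φ (t, t) - θ t) (by fun_prop) (by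
      intro t
      have h1 := hΦ' (t, t)
      simp only [secDir, if_true] at h1
      have h2 : Complex.exp ((Φ (t, t) - θ t : ℝ) * Complex.I) = 1 := by
        push_cast
        rw [sub_mul, Complex.exp_sub, h1, div_self (Complex.exp_ne_zero _)]
      have h3 := congrArg Complex.re h2
      rwa [Complex.exp_ofReal_mul_I_re, Complex.one_re] at h3) a b hab
    linarith
  · intro s t hst
    have h0 : z t - z s ≠ 0 := by
      rw [sub_ne_zero]; exact fun hh => hst.ne' (hinj hh)
    refine ⟨‖z t - z s‖, norm_pos_iff.2 h0, ?_⟩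
    rw [hΦ']
    have h1 : (‖z t - z s‖ : ℂ) ≠ 0 := by simpa using h0
    simp only [secDir, hst.ne, if_false, max_eq_right hst.le, min_eq_left hst.le]
    field_simp

lemma exp_period (x y : ℝ) (n : ℤ) (h : x = y + 2 * π * n) :
    Complex.exp (x * Complex.I) = Complex.exp (y * Complex.I) := by
  rw [Complex.exp_eq_exp_iff_exists_int]
  exact ⟨n, by rw [h]; push_cast; ring⟩

lemma core (z : ℝ → ℂ) (r θ : ℝ → ℝ) (hr : ∀ t, 0 < r t) (hθ : Continuous θ)
    (hz : ∀ t, HasDerivAt z (r t * Complex.exp (θ t * Complex.I)) t)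
    (hinj : Function.Injective z) (a b : ℝ) (hab : a < b)
    (hni : (∀ t ∈ Ioo a b, ∀ c : ℝ, 0 < c → c < 1 → z t - z a ≠ c * (z b - z a)) ∨
      (∀ t ∈ Ioo a b, ∀ c : ℝ, (c < 0 ∨ 1 < c) → z t - z a ≠ c * (z b - z a))) :
    |θ a - θ b| ≤ 4 * π := by
  have hpi := Real.pi_pos
  have hzc : Continuous z := continuous_iff_continuousAt.2 fun t => (hz t).continuousAt
  obtain ⟨Φ, hΦ, hdiag, hsec⟩ := exists_lift z r θ hr hθ hz hinj
  have hd := hdiag a b hab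
  set δ := Φ (a, b) with hδ
  obtain ⟨R, hR, hRe⟩ := hsec a b hab
  rw [← hδ] at hRe
  have hcα : Continuous fun t => Φ (a, t) := by fun_prop
  have hcβ : Continuous fun t => Φ (t, b) := by fun_prop
  have hRc : (R : ℂ) ≠ 0 := by exact_mod_cast hR.ne'
  rcases hni with h | h
  · -- Umlaufsatz case
    obtain ⟨k, hk1, hk2⟩ := trap (fun t => Φ (a, t) - Φ (t, b)) (hcα.sub hcβ) a b 0 hab (by
      intro t ht n hn
      obtain ⟨ρ, hρ, e1⟩ := hsec a t ht.1
      obtain ⟨σ, hσ, e2⟩ := hsec t b ht.2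
      have e3 := exp_period (Φ (a, t)) (Φ (t, b)) n (by linarith)
      refine h t ht (ρ / (ρ + σ)) (by positivity) ?_ ?_
      · rw [div_lt_one (by positivity)]; linarith
      · have hs : ((ρ : ℂ) + σ) ≠ 0 := by exact_mod_cast (add_pos hρ hσ).ne'
        have : z b - z a = (ρ + σ) * Complex.exp (Φ (t, b) * Complex.I) := by
          rw [← e3] at e2 ⊢
          linear_combination e1 + e2
        rw [this, e1, e3]
        push_cast
        field_simp)
    simp only [zero_add] at hk1 hk2
    -- extreme point
    have hyc : Continuous fun t => ((z t - z a) * Complex.exp ((-δ : ℝ) * Complex.I)).im :=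
      Complex.continuous_im.comp ((hzc.sub continuous_const).mul continuous_const)
    have hyb : ((z b - z a) * Complex.exp ((-δ : ℝ) * Complex.I)).im = 0 := by
      rw [hRe, mul_assoc, ← Complex.exp_add]
      push_cast
      rw [show (δ : ℂ) * Complex.I + -δ * Complex.I = 0 by ring]
      simp
    obtain ⟨t₀, ht₀, hext⟩ := exists_Ioo_extr_on_Icc hab hyc.continuousOn (by
      simp only [sub_self, zero_mul, Complex.zero_im]; exact hyb.symm)
    have hdiff : ∀ s t, s < t → ∃ ρ : ℝ, 0 < ρ ∧
        ((z t - z a) * Complex.exp ((-δ : ℝ) * Complex.I)).im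
        - ((z s - z a) * Complex.exp ((-δ : ℝ) * Complex.I)).im
          = ρ * Real.sin (Φ (s, t) - δ) := by
      intro s t hst
      obtain ⟨ρ, hρ, e⟩ := hsec s t hst
      refine ⟨ρ, hρ, ?_⟩
      rw [← Complex.sub_im, ← sub_mul, sub_sub_sub_cancel_right, e, mul_assoc, ← Complex.exp_add,
        ← add_mul, ← Complex.ofReal_add, Complex.im_ofReal_mul, Complex.exp_ofReal_mul_I_im,
        ← sub_eq_add_neg]
    have hc1 : Continuous fun t => Φ (t₀, t) := by fun_prop
    have hc2 : Continuous fun t => Φ (t, t₀) := by fun_prop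
    have hbound : |Φ (t₀, t₀) - Φ (t₀, b)| ≤ π ∧ |Φ (a, t₀) - Φ (t₀, t₀)| ≤ π := by
      rcases hext with hmin | hmax
      · constructor
        · refine half_plane _ hc1 t₀ b δ ht₀.2 ?_
          intro t ht
          obtain ⟨ρ, hρ, e⟩ := hdiff t₀ t ht.1
          have := hmin (show t ∈ Icc a b from ⟨(ht₀.1.trans ht.1).le, ht.2.le⟩)
          simp only [mem_ofPred_eq] at this
          refine nonneg_of_mul_nonneg_right (a := ρ) ?_ hρ
          linarith
        · refine half_plane _ hc2 a t₀ (δ + π) ht₀.1 ?_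
          intro t ht
          obtain ⟨ρ, hρ, e⟩ := hdiff t t₀ ht.2
          have := hmin (show t ∈ Icc a b from ⟨ht.1.le, (ht.2.trans ht₀.2).le⟩)
          simp only [mem_ofPred_eq] at this
          rw [← sub_sub, Real.sin_sub_pi]
          refine nonneg_of_mul_nonneg_right (a := ρ) ?_ hρ
          linarith
      · constructor
        · refine half_plane _ hc1 t₀ b (δ + π) ht₀.2 ?_
          intro t ht
          obtain ⟨ρ, hρ, e⟩ := hdiff t₀ t ht.1
          have := hmax (show t ∈ Icc a b from ⟨(ht₀.1.trans ht.1).le, ht.2.le⟩)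
          simp only [mem_ofPred_eq] at this
          rw [← sub_sub, Real.sin_sub_pi]
          refine nonneg_of_mul_nonneg_right (a := ρ) ?_ hρ
          linarith
        · refine half_plane _ hc2 a t₀ δ ht₀.1 ?_
          intro t ht
          obtain ⟨ρ, hρ, e⟩ := hdiff t t₀ ht.2
          have := hmax (show t ∈ Icc a b from ⟨ht.1.le, (ht.2.trans ht₀.2).le⟩)
          simp only [mem_ofPred_eq] at this
          refine nonneg_of_mul_nonneg_right (a := ρ) ?_ hρ
          linarith
    obtain ⟨hb1, hb2⟩ := hbound
    rw [abs_le] at hb1 hb2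
    obtain ⟨q1, q2⟩ := hk1 t₀ ht₀
    have hklt : (k : ℝ) < 1 := by
      by_contra hcon
      push Not at hcon
      nlinarith
    have hkgt : (-2 : ℝ) < k := by
      by_contra hcon
      push Not at hcon
      nlinarith
    have hklt' : k < 1 := by exact_mod_cast hklt
    have hkgt' : -2 < k := by exact_mod_cast hkgt
    obtain ⟨a1, a2⟩ := hk2 a ⟨le_refl _, hab.le⟩
    obtain ⟨b1, b2⟩ := hk2 b ⟨hab.le, le_refl _⟩
    have hkc : k = 0 ∨ k = -1 := by omega
    rw [abs_le]
    rcases hkc with rfl | rfl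
    · push_cast at *
      constructor <;> linarith
    · push_cast at *
      constructor <;> linarith
  · obtain ⟨k, -, hk⟩ := trap (fun t => Φ (a, t)) hcα a b (δ + π) hab (by
      intro t ht n hn
      obtain ⟨ρ, hρ, e1⟩ := hsec a t ht.1
      have e3 := exp_period (Φ (a, t)) (δ + π) n hn
      have e4 : Complex.exp (((δ + π : ℝ) : ℂ) * Complex.I) = - Complex.exp (δ * Complex.I) := by
        push_cast
        rw [add_mul, Complex.exp_add, Complex.exp_pi_mul_I]; ring
      refine h t ht (-(ρ / R)) (Or.inl ?_) ?_
      · have : 0 < ρ / R := by positivity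
        linarith
      · rw [e1, hRe, e3, e4]
        push_cast
        field_simp)
    obtain ⟨l, -, hl⟩ := trap (fun t => Φ (t, b)) hcβ a b (δ + π) hab (by
      intro t ht n hn
      obtain ⟨ρ, hρ, e1⟩ := hsec t b ht.2
      have e3 := exp_period (Φ (t, b)) (δ + π) n hn
      have e4 : Complex.exp (((δ + π : ℝ) : ℂ) * Complex.I) = - Complex.exp (δ * Complex.I) := by
        push_cast
        rw [add_mul, Complex.exp_add, Complex.exp_pi_mul_I]; ring
      refine h t ht (1 + ρ / R) (Or.inr ?_) ?_
      · have : 0 < ρ / R := by positivity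
        linarith
      · have : z t - z a = (z b - z a) - (z b - z t) := by ring
        rw [this, e1, hRe, e3, e4]
        push_cast
        field_simp
        ring)
    have fin : ∀ j : ℤ, δ + π + 2 * π * j ≤ δ → δ ≤ δ + π + 2 * π * j + 2 * π → j = -1 := by
      intro j h1 h2
      have hj1 : (j : ℝ) < 0 := by
        by_contra hcon
        push Not at hcon
        nlinarith
      have hj2 : (-2 : ℝ) < j := by
        by_contra hcon
        push Not at hcon
        nlinarith
      have hj1' : j < 0 := by exact_mod_cast hj1
      have hj2' : -2 < j := by exact_mod_cast hj2
      omega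
    have hkb := hk b ⟨hab.le, le_refl _⟩
    have hla := hl a ⟨le_refl _, hab.le⟩
    have hk' := fin k hkb.1 hkb.2
    have hl' := fin l hla.1 hla.2
    have hka := hk a ⟨le_refl _, hab.le⟩
    have hlb := hl b ⟨hab.le, le_refl _⟩
    rw [hk'] at hka
    rw [hl'] at hlb
    push_cast at hka hlb
    rw [abs_le]
    constructor <;> linarith

theorem stmt_11 (ξ : ℝ → V2) (ξ' : ℝ → V2) (hξ : ∀ t, HasDerivAt ξ (ξ' t) t)
    (hinj : Function.Injective ξ) (hne : ∀ t, ξ' t ≠ 0)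
    (θ : ℝ → ℝ) (hθ : Continuous θ)
    (harg : ∀ t, ξ' t = ‖ξ' t‖ • mk2 (Real.cos (θ t)) (Real.sin (θ t)))
    (a b : ℝ) (hab : a < b)
    (hni : (ξ '' Set.Icc a b) ∩ openSegment ℝ (ξ a) (ξ b) = ∅ ∨
           (ξ '' Set.Icc a b) ∩ (lineThrough (ξ a) (ξ b) \ segment ℝ (ξ a) (ξ b)) = ∅) :
    |θ a - θ b| ≤ 4 * Real.pi := by
  have hmk0 : ∀ x y : ℝ, mk2 x y 0 = x := fun x y => rfl
  have hmk1 : ∀ x y : ℝ, mk2 x y 1 = y := fun x y => rfl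
  let Z : V2 → ℂ := fun v => ⟨v 0, v 1⟩
  have hZinj : Function.Injective Z := by
    intro v w hvw
    have h0 := congrArg Complex.re hvw
    have h1 := congrArg Complex.im hvw
    ext i
    fin_cases i
    · exact h0
    · exact h1
  have hco : ∀ (i : Fin 2) t, HasDerivAt (fun t => ξ t i) (ξ' t i) t := fun i t =>
    (EuclideanSpace.proj i : V2 →L[ℝ] ℝ).hasFDerivAt.comp_hasDerivAt t (hξ t)
  have hZd : ∀ t, HasDerivAt (fun t => Z (ξ t))
      ((‖ξ' t‖ : ℝ) * Complex.exp (θ t * Complex.I)) t := by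
    intro t
    have h0 := ((hco 0 t).ofReal_comp).add (((hco 1 t).ofReal_comp).mul_const Complex.I)
    have e0 : ξ' t 0 = ‖ξ' t‖ * Real.cos (θ t) := by
      conv_lhs => rw [harg t]
      simp [hmk0]
    have e1 : ξ' t 1 = ‖ξ' t‖ * Real.sin (θ t) := by
      conv_lhs => rw [harg t]
      simp [hmk1]
    have hfun : (fun t => Z (ξ t)) =
        ((fun y => ((ξ y 0 : ℝ) : ℂ)) + fun y => ((ξ y 1 : ℝ) : ℂ) * Complex.I) := by
      funext u
      exact Complex.mk_eq_add_mul_I _ _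
    rw [hfun]
    refine h0.congr_deriv ?_
    · rw [e0, e1, Complex.exp_mul_I]
      push_cast
      ring
  refine core (fun t => Z (ξ t)) (fun t => ‖ξ' t‖) θ (fun t => norm_pos_iff.2 (hne t)) hθ hZd
    (hZinj.comp hinj) a b hab ?_
  have hlin : ∀ t (c : ℝ), Z (ξ t) - Z (ξ a) = c * (Z (ξ b) - Z (ξ a)) →
      ξ t = ξ a + c • (ξ b - ξ a) := by
    intro t c h
    have h0 := congrArg Complex.re h
    have h1 := congrArg Complex.im h
    rw [Complex.re_ofReal_mul] at h0
    rw [Complex.im_ofReal_mul] at h1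
    simp only [Complex.sub_re, Complex.sub_im, Z] at h0 h1
    ext i
    fin_cases i
    · simp; linarith
    · simp; linarith
  rcases hni with h | h
  · left
    intro t ht c hc0 hc1 he
    have := hlin t c he
    refine (Set.eq_empty_iff_forall_notMem.1 h) (ξ t) ⟨⟨t, ⟨ht.1.le, ht.2.le⟩, rfl⟩, ?_⟩
    rw [openSegment_eq_image']
    exact ⟨c, ⟨hc0, hc1⟩, this.symm⟩
  · right
    intro t ht c hc he
    have := hlin t c he
    refine (Set.eq_empty_iff_forall_notMem.1 h) (ξ t)
      ⟨⟨t, ⟨ht.1.le, ht.2.le⟩, rfl⟩, ⟨c, this⟩, ?_⟩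
    rw [segment_eq_image']
    rintro ⟨d, hd, hde⟩
    simp only at hde
    rw [this, add_right_inj] at hde
    have hba : ξ b - ξ a ≠ 0 := by
      rw [sub_ne_zero]; exact fun hh => hab.ne' (hinj hh)
    have := smul_left_injective ℝ hba hde
    subst this
    rcases hc with hc | hc
    · linarith [hd.1]
    · linarith [hd.2]
end
end

section
/- Main theorem (Liouville theorem for planar Euler flows): Let v be a C^2 bounded solution of the steady incompressible Euler equations v·∇v + ∇p = 0, div v = 0 in R^2 with inf_{R^2} |v| > 0. Then v is a shear flow: there exist a unit vector e ∈ S^1 and a continuous function V : R → R of constant strict sign such that v(x) = V(x · e^⊥) e for all x ∈ R^2. -/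
open Real Set Filter MeasureTheory

noncomputable section

abbrev R2 : Type := ℝ × ℝ
def dx (f : R2 → ℝ) (z : R2) : ℝ := fderiv ℝ f z (1, 0)
def dy (f : R2 → ℝ) (z : R2) : ℝ := fderiv ℝ f z (0, 1)

lemma dx_mul {f g : R2 → ℝ} (hf : ContDiff ℝ 1 f) (hg : ContDiff ℝ 1 g) (z : R2) :
    dx (fun w => f w * g w) z = dx f z * g z + f z * dx g z := by
  have h1 := (hf.differentiable one_ne_zero z).hasFDerivAt
  have h2 := (hg.differentiable one_ne_zero z).hasFDerivAt
  have := (h1.mul h2).fderiv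
  change fderiv ℝ (f * g) z (1, 0) = _
  rw [this]; simp [dx]; ring
lemma dy_mul {f g : R2 → ℝ} (hf : ContDiff ℝ 1 f) (hg : ContDiff ℝ 1 g) (z : R2) :
    dy (fun w => f w * g w) z = dy f z * g z + f z * dy g z := by
  have h1 := (hf.differentiable one_ne_zero z).hasFDerivAt
  have h2 := (hg.differentiable one_ne_zero z).hasFDerivAt
  have := (h1.mul h2).fderiv
  change fderiv ℝ (f * g) z (0, 1) = _
  rw [this]; simp [dy]; ring
lemma dx_add {f g : R2 → ℝ} (hf : ContDiff ℝ 1 f) (hg : ContDiff ℝ 1 g) (z : R2) :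
    dx (fun w => f w + g w) z = dx f z + dx g z := by
  have h1 := (hf.differentiable one_ne_zero z)
  have h2 := (hg.differentiable one_ne_zero z)
  have := fderiv_add h1 h2
  change fderiv ℝ (f + g) z (1, 0) = _
  rw [this]; simp [dx]
lemma dy_add {f g : R2 → ℝ} (hf : ContDiff ℝ 1 f) (hg : ContDiff ℝ 1 g) (z : R2) :
    dy (fun w => f w + g w) z = dy f z + dy g z := by
  have h1 := (hf.differentiable one_ne_zero z)
  have h2 := (hg.differentiable one_ne_zero z)
  have := fderiv_add h1 h2
  change fderiv ℝ (f + g) z (0, 1) = _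
  rw [this]; simp [dy]
lemma dx_sub {f g : R2 → ℝ} (hf : ContDiff ℝ 1 f) (hg : ContDiff ℝ 1 g) (z : R2) :
    dx (fun w => f w - g w) z = dx f z - dx g z := by
  have h1 := (hf.differentiable one_ne_zero z)
  have h2 := (hg.differentiable one_ne_zero z)
  have := fderiv_sub h1 h2
  change fderiv ℝ (f - g) z (1, 0) = _
  rw [this]; simp [dx]
lemma dy_sub {f g : R2 → ℝ} (hf : ContDiff ℝ 1 f) (hg : ContDiff ℝ 1 g) (z : R2) :
    dy (fun w => f w - g w) z = dy f z - dy g z := by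
  have h1 := (hf.differentiable one_ne_zero z)
  have h2 := (hg.differentiable one_ne_zero z)
  have := fderiv_sub h1 h2
  change fderiv ℝ (f - g) z (0, 1) = _
  rw [this]; simp [dy]
lemma dx_neg (f : R2 → ℝ) (z : R2) : dx (fun w => - f w) z = - dx f z := by
  simp [dx, fderiv_fun_neg]
lemma dy_neg (f : R2 → ℝ) (z : R2) : dy (fun w => - f w) z = - dy f z := by
  simp [dy, fderiv_fun_neg]
lemma dx_const (c : ℝ) (z : R2) : dx (fun _ => c) z = 0 := by simp [dx]
lemma dy_const (c : ℝ) (z : R2) : dy (fun _ => c) z = 0 := by simp [dy]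
lemma dx_fst (z : R2) : dx (fun w => w.1) z = 1 := by simp [dx, fderiv_fst]
lemma dy_fst (z : R2) : dy (fun w => w.1) z = 0 := by simp [dy, fderiv_fst]

lemma contDiff_dx {f : R2 → ℝ} {n : ℕ} (hf : ContDiff ℝ (n + 1 : ℕ) f) : ContDiff ℝ n (dx f) := by
  unfold dx
  exact (hf.fderiv_right (m := n) (by norm_cast)).clm_apply contDiff_const
lemma contDiff_dy {f : R2 → ℝ} {n : ℕ} (hf : ContDiff ℝ (n + 1 : ℕ) f) : ContDiff ℝ n (dy f) := by
  unfold dy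
  exact (hf.fderiv_right (m := n) (by norm_cast)).clm_apply contDiff_const
lemma cont_dx {f : R2 → ℝ} (hf : ContDiff ℝ 1 f) : Continuous (dx f) :=
  (contDiff_dx (n := 0) (by simpa using hf)).continuous
lemma cont_dy {f : R2 → ℝ} (hf : ContDiff ℝ 1 f) : Continuous (dy f) :=
  (contDiff_dy (n := 0) (by simpa using hf)).continuous
lemma c1_dx {f : R2 → ℝ} (hf : ContDiff ℝ 2 f) : ContDiff ℝ 1 (dx f) :=
  (contDiff_dx (n := 1) (by simpa using hf))
lemma c1_dy {f : R2 → ℝ} (hf : ContDiff ℝ 2 f) : ContDiff ℝ 1 (dy f) :=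
  (contDiff_dy (n := 1) (by simpa using hf))

lemma dx_dy_comm {f : R2 → ℝ} (hf : ContDiff ℝ 2 f) (z : R2) : dx (dy f) z = dy (dx f) z := by
  have hs : IsSymmSndFDerivAt ℝ f z := hf.contDiffAt.isSymmSndFDerivAt (by simp)
  have h2 : DifferentiableAt ℝ (fderiv ℝ f) z :=
    (hf.fderiv_right (m := 1) (by norm_num)).differentiable one_ne_zero z
  have := hs (1, 0) (0, 1)
  unfold dx dy
  rw [fderiv_clm_apply h2 (by fun_prop), fderiv_clm_apply h2 (by fun_prop)]
  simpa using this

lemma integral_fderiv_zero {f : R2 → ℝ} (hf : ContDiff ℝ 1 f) (hs : HasCompactSupport f) (e : R2) :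
    Integrable (fun z => fderiv ℝ f z e) ∧ ∫ z, fderiv ℝ f z e = 0 := by
  have hc : Continuous (fun z => fderiv ℝ f z e) :=
    (hf.continuous_fderiv one_ne_zero).clm_apply continuous_const
  have hs' : HasCompactSupport (fun z => fderiv ℝ f z e) := (hs.fderiv_apply ℝ e)
  have hi := hc.integrable_of_hasCompactSupport (μ := volume) hs'
  refine ⟨hi, ?_⟩
  have := integral_mul_fderiv_eq_neg_fderiv_mul_of_integrable (μ := (volume : Measure R2)) (𝕜 := ℝ) (f := fun _ => (1:ℝ)) (g := f) (v := e)
    (by simp) (by simpa using hi) (by simpa using hf.continuous.integrable_of_hasCompactSupport hs)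
    (by simp) (fun x _ => hf.differentiable one_ne_zero x)
  simpa using this

lemma exists_potential {f g : R2 → ℝ} (hf : ContDiff ℝ 1 f) (hg : ContDiff ℝ 1 g)
    (h : ∀ z, dy f z = dx g z) :
    ∃ G : R2 → ℝ, ContDiff ℝ 1 G ∧ (∀ z, dx G z = f z) ∧ ∀ z, dy G z = g z := by
  let ω : R2 → (R2 →L[ℝ] ℝ) := fun z => f z • ContinuousLinearMap.fst ℝ ℝ ℝ + g z • ContinuousLinearMap.snd ℝ ℝ ℝ
  have hω : ContDiff ℝ 1 ω := (hf.smul contDiff_const).add (hg.smul contDiff_const)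
  have hd : ∀ z (a b : R2), fderiv ℝ ω z a b = fderiv ℝ f z a * b.1 + fderiv ℝ g z a * b.2 := by
    intro z a b
    have h1 := (hf.differentiable one_ne_zero z).hasFDerivAt.smul_const (ContinuousLinearMap.fst ℝ ℝ ℝ)
    have h2 := (hg.differentiable one_ne_zero z).hasFDerivAt.smul_const (ContinuousLinearMap.snd ℝ ℝ ℝ)
    have h3 : HasFDerivAt ω _ z := h1.add h2
    rw [h3.fderiv]; simp
  have hlin : ∀ (l : R2 →L[ℝ] ℝ) (a : R2), l a = a.1 * l (1,0) + a.2 * l (0,1) := by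
    intro l a
    have : a = a.1 • ((1:ℝ),(0:ℝ)) + a.2 • ((0:ℝ),(1:ℝ)) := by ext <;> simp
    conv_lhs => rw [this]
    simp only [map_add, map_smul, smul_eq_mul]
  obtain ⟨G, hG⟩ := convex_univ.exists_forall_hasFDerivAt_of_fderiv_symmetric (ω := ω) isOpen_univ
    (hω.differentiable one_ne_zero).differentiableOn (by
      intro z _ a b
      rw [hd, hd, hlin (fderiv ℝ f z) a, hlin (fderiv ℝ f z) b, hlin (fderiv ℝ g z) a, hlin (fderiv ℝ g z) b]
      have := h z
      unfold dx dy at this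
      rw [this]; ring)
  have hG' : fderiv ℝ G = ω := by ext1 z; exact (hG z (mem_univ _)).fderiv
  refine ⟨G, ?_, ?_, ?_⟩
  · rw [contDiff_one_iff_fderiv, hG']
    exact ⟨fun z => (hG z (mem_univ _)).differentiableAt, hω.continuous⟩
  · intro z; simp [dx, hG', ω]
  · intro z; simp [dy, hG', ω]
lemma slice_x {f : R2 → ℝ} (hf : ContDiff ℝ 1 f) (x y : ℝ) :
    HasDerivAt (fun t => f (t, y)) (dx f (x, y)) x := by
  have h1 := (hf.differentiable one_ne_zero (x, y)).hasFDerivAt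
  have h2 : HasDerivAt (fun t : ℝ => (t, y)) ((1 : ℝ), (0 : ℝ)) x :=
    (hasDerivAt_id x).prodMk (hasDerivAt_const x y)
  exact h1.comp_hasDerivAt x h2

lemma slice_y {f : R2 → ℝ} (hf : ContDiff ℝ 1 f) (x y : ℝ) :
    HasDerivAt (fun t => f (x, t)) (dy f (x, y)) y := by
  have h1 := (hf.differentiable one_ne_zero (x, y)).hasFDerivAt
  have h2 : HasDerivAt (fun t : ℝ => (x, t)) ((0 : ℝ), (1 : ℝ)) y :=
    (hasDerivAt_const y x).prodMk (hasDerivAt_id y)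
  exact h1.comp_hasDerivAt y h2

lemma hasDerivAt_strip {f : R2 → ℝ} (hf : ContDiff ℝ 1 f) (S x₀ : ℝ) :
    HasDerivAt (fun x => ∫ y in (-S)..S, f (x, y)) (∫ y in (-S)..S, dx f (x₀, y)) x₀ := by
  have hK : IsCompact (Icc (x₀ - 1) (x₀ + 1) ×ˢ uIcc (-S) S) := isCompact_Icc.prod isCompact_uIcc
  obtain ⟨B, hB⟩ := hK.exists_bound_of_continuousOn (cont_dx hf).continuousOn
  have hc := hf.continuous
  have hc' := cont_dx hf
  refine (intervalIntegral.hasDerivAt_integral_of_dominated_loc_of_deriv_le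
    (F := fun x y => f (x, y)) (F' := fun x y => dx f (x, y)) (bound := fun _ => B)
    (s := Icc (x₀ - 1) (x₀ + 1)) (Icc_mem_nhds (by linarith) (by linarith)) ?_ ?_ ?_ ?_ ?_ ?_).2
  · exact Eventually.of_forall fun x => (by fun_prop : Continuous fun y => f (x, y)).aestronglyMeasurable
  · exact (by fun_prop : Continuous fun y => f (x₀, y)).intervalIntegrable _ _
  · exact (by fun_prop : Continuous fun y => dx f (x₀, y)).aestronglyMeasurable
  · exact Eventually.of_forall fun y hy x hx => hB (x, y) ⟨hx, uIoc_subset_uIcc hy⟩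
  · exact intervalIntegrable_const
  · exact Eventually.of_forall fun y hy x hx => slice_x hf x y

lemma mvt_bound {f f' : ℝ → ℝ} {S K : ℝ} (h : ∀ x, HasDerivAt f (f' x) x)
    (hb : ∀ x, |x| ≤ S → |f' x| ≤ K) {x y : ℝ} (hx : |x| ≤ S) (hy : |y| ≤ S) :
    |f y - f x| ≤ K * |y - x| := by
  have := (convex_Icc (-S) S).norm_image_sub_le_of_norm_hasDerivWithin_le (f := f) (f' := f') (C := K)
    (fun x _ => (h x).hasDerivWithinAt) (fun x hx => hb x (abs_le.2 hx)) (abs_le.1 hx) (abs_le.1 hy)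
  simpa using this

lemma G_bound {T A B G : R2 → ℝ} {M S : ℝ} (hT : ContDiff ℝ 1 T) (hA : ContDiff ℝ 1 A)
    (hB : ContDiff ℝ 1 B) (hG : ContDiff ℝ 1 G) (hGx : ∀ z, dx G z = B z)
    (hGy : ∀ z, dy G z = - T z) (hAT : ∀ z, dx A z = - dy T z) (bT : ∀ z, |T z| ≤ M)
    (bAB : ∀ z, |B z - A z| ≤ M) (hS : 0 < S) :
    ∃ c d : ℝ, ∀ z : R2, |z.1| ≤ S → |z.2| ≤ S → |G z - c * z.1 - d| ≤ 4 * M * S := by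
  have hM : 0 ≤ M := (abs_nonneg _).trans (bT 0)
  have cT := hT.continuous
  have cA := hA.continuous
  have cB := hB.continuous
  have cG := hG.continuous
  set m : ℝ → ℝ := fun x => ∫ y in (-S)..S, A (x, y) with hm
  set Φ : ℝ → ℝ := fun x => ∫ y in (-S)..S, G (x, y) with hΦ
  have dm : ∀ x, HasDerivAt m (-(T (x, S) - T (x, -S))) x := by
    intro x
    have h1 := hasDerivAt_strip hA S x
    have h2 : ∫ y in (-S)..S, dx A (x, y) = -(T (x, S) - T (x, -S)) := by
      simp only [hAT, intervalIntegral.integral_neg]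
      rw [intervalIntegral.integral_eq_sub_of_hasDerivAt (f := fun y => T (x, y))]
      · intro y _; exact slice_y hT x y
      · have := cont_dy hT
        exact (by fun_prop : Continuous fun y => dy T (x, y)).intervalIntegrable _ _
    rwa [h2] at h1
  have bm : ∀ x, |x| ≤ S → |m x - m 0| ≤ 2 * M * S := by
    intro x hx
    have := mvt_bound (S := S) (K := 2 * M) dm (fun x _ => by
      have h1 := abs_le.1 (bT (x, S)); have h2 := abs_le.1 (bT (x, -S))
      rw [abs_le]; constructor <;> linarith) (x := 0) (y := x) (by simpa using hS.le) hx
    rw [sub_zero] at this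
    nlinarith
  have dΦ : ∀ x, HasDerivAt (fun x => Φ x - m 0 * x) ((∫ y in (-S)..S, B (x, y)) - m 0) x := by
    intro x
    have h1 := hasDerivAt_strip hG S x
    simp only [hGx] at h1
    have h2 := h1.sub ((hasDerivAt_id x).const_mul (m 0))
    rw [mul_one] at h2
    exact h2
  have bΦ : ∀ x, |x| ≤ S → |Φ x - m 0 * x - Φ 0| ≤ 4 * M * S * S := by
    intro x hx
    have := mvt_bound (S := S) (K := 4 * M * S) dΦ (fun x hx => by
      have h1 : (∫ y in (-S)..S, B (x, y)) - m x = ∫ y in (-S)..S, (B (x, y) - A (x, y)) := by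
        rw [hm]
        rw [intervalIntegral.integral_sub]
        · exact (by fun_prop : Continuous fun y => B (x, y)).intervalIntegrable _ _
        · exact (by fun_prop : Continuous fun y => A (x, y)).intervalIntegrable _ _
      have h2 : ‖∫ y in (-S)..S, (B (x, y) - A (x, y))‖ ≤ M * |S - (-S)| :=
        intervalIntegral.norm_integral_le_of_norm_le_const (fun y _ => bAB (x, y))
      rw [abs_of_pos (by linarith : 0 < S - (-S)), ← h1, Real.norm_eq_abs] at h2
      have h3 := abs_le.1 h2
      have h4 := abs_le.1 (bm x hx)
      rw [abs_le]; constructor <;> linarith) (x := 0) (y := x) (by simpa using hS.le) hx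
    rw [sub_zero, mul_zero, sub_zero] at this
    have h5 : 4 * M * S * |x| ≤ 4 * M * S * S := by gcongr
    exact this.trans h5
  have bG : ∀ x y, |y| ≤ S → |2 * S * G (x, y) - Φ x| ≤ 2 * M * S * (2 * S) := by
    intro x y hy
    have h1 : 2 * S * G (x, y) - Φ x = ∫ y' in (-S)..S, (G (x, y) - G (x, y')) := by
      rw [intervalIntegral.integral_sub]
      · rw [intervalIntegral.integral_const, smul_eq_mul]; ring
      · exact intervalIntegrable_const
      · exact (by fun_prop : Continuous fun y => G (x, y)).intervalIntegrable _ _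
    have h2 : ‖∫ y' in (-S)..S, (G (x, y) - G (x, y'))‖ ≤ 2 * M * S * |S - (-S)| := by
      refine intervalIntegral.norm_integral_le_of_norm_le_const (fun y' hy' => ?_)
      rw [uIoc_of_le (by linarith)] at hy'
      have hy2 : |y'| ≤ S := abs_le.2 ⟨hy'.1.le, hy'.2⟩
      have h3 := mvt_bound (S := S) (K := M) (fun t => slice_y hG x t)
        (fun t _ => by rw [hGy, abs_neg]; exact bT _) hy2 hy
      have h4 : |y - y'| ≤ 2 * S := by
        have := abs_le.1 hy; have := abs_le.1 hy2
        rw [abs_le]; constructor <;> linarith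
      rw [Real.norm_eq_abs]
      nlinarith
    rw [abs_of_pos (by linarith : 0 < S - (-S)), ← h1, Real.norm_eq_abs] at h2
    linarith
  refine ⟨m 0 / (2 * S), Φ 0 / (2 * S), fun z hz1 hz2 => ?_⟩
  have h1 := abs_le.1 (bG z.1 z.2 hz2)
  have h2 := abs_le.1 (bΦ z.1 hz1)
  have h3 : G z - m 0 / (2 * S) * z.1 - Φ 0 / (2 * S) = (2 * S * G z - m 0 * z.1 - Φ 0) / (2 * S) := by
    field_simp
  rw [h3, abs_div, abs_of_pos (by linarith : 0 < 2 * S), div_le_iff₀ (by linarith), abs_le]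
  have hz : G (z.1, z.2) = G z := rfl
  rw [hz] at h1
  constructor <;> nlinarith [h1.1, h1.2, h2.1, h2.2]

/-- The cutoff family. -/
structure CutoffFam (ζ : ℝ → R2 → ℝ) (L : ℝ) : Prop where
  cd : ∀ R, ContDiff ℝ 1 (ζ R)
  cs : ∀ R, 0 < R → HasCompactSupport (ζ R)
  nonneg : ∀ R z, 0 ≤ ζ R z
  le_one : ∀ R z, ζ R z ≤ 1
  one : ∀ R z, 0 < R → ‖z‖ ≤ R → ζ R z = 1
  zero : ∀ R z, 0 < R → 2 * R ≤ ‖z‖ → ζ R z = 0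
  bx : ∀ R z, 0 < R → |dx (ζ R) z| ≤ L / R
  bdy : ∀ R z, 0 < R → |dy (ζ R) z| ≤ L / R
  in0 : ∀ R z, 0 < R → ‖z‖ < R → dx (ζ R) z = 0 ∧ dy (ζ R) z = 0
  out0 : ∀ R z, 0 < R → 2 * R < ‖z‖ → dx (ζ R) z = 0 ∧ dy (ζ R) z = 0
  int : ∀ R, 0 < R → ∫ z, (ζ R z) ^ 2 ≤ 16 * R ^ 2

lemma exists_cutoff : ∃ (ζ : ℝ → R2 → ℝ) (L : ℝ), 0 ≤ L ∧ CutoffFam ζ L := by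
  let β : ContDiffBump (0 : R2) := ⟨1, 2, one_pos, one_lt_two⟩
  have hβ : ContDiff ℝ 1 β := β.contDiff
  have hdc : Continuous (fderiv ℝ (β : R2 → ℝ)) := hβ.continuous_fderiv one_ne_zero
  obtain ⟨L, hL⟩ := (β.hasCompactSupport.fderiv ℝ).exists_bound_of_continuous hdc
  have hL0 : 0 ≤ L := (norm_nonneg _).trans (hL 0)
  let ζ : ℝ → R2 → ℝ := fun R z => β (R⁻¹ • z)
  have hcd : ∀ R, ContDiff ℝ 1 (ζ R) := fun R => hβ.comp (by fun_prop)
  have hfd : ∀ R z, fderiv ℝ (ζ R) z = R⁻¹ • fderiv ℝ (β : R2 → ℝ) (R⁻¹ • z) := by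
    intro R z
    have h1 := (hβ.differentiable one_ne_zero (R⁻¹ • z)).hasFDerivAt
    have h2 : HasFDerivAt (fun w : R2 => R⁻¹ • w) (R⁻¹ • ContinuousLinearMap.id ℝ R2) z :=
      (hasFDerivAt_id z).const_smul R⁻¹
    have h3 := (h1.comp z h2).fderiv
    have h4 : fderiv ℝ (ζ R) z = _ := h3
    rw [h4]; ext <;> simp
  have hzero : ∀ R z, 0 < R → 2 * R ≤ ‖z‖ → ζ R z = 0 := by
    intro R z hR hz
    apply β.zero_of_le_dist
    rw [dist_zero_right, norm_smul, norm_inv, Real.norm_of_nonneg hR.le]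
    change (2:ℝ) ≤ _
    rw [inv_mul_eq_div, le_div_iff₀ hR]; exact hz
  have hone : ∀ R z, 0 < R → ‖z‖ ≤ R → ζ R z = 1 := by
    intro R z hR hz
    apply β.one_of_mem_closedBall
    rw [mem_closedBall_zero_iff, norm_smul, norm_inv, Real.norm_of_nonneg hR.le]
    change _ ≤ (1:ℝ)
    rw [inv_mul_eq_div, div_le_iff₀ hR, one_mul]; exact hz
  have hcs : ∀ R, 0 < R → HasCompactSupport (ζ R) := by
    intro R hR
    refine HasCompactSupport.intro (isCompact_closedBall (0 : R2) (2 * R)) (fun z hz => ?_)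
    apply hzero R z hR
    rw [mem_closedBall_zero_iff, not_le] at hz
    exact hz.le
  have hb : ∀ R z (e : R2), 0 < R → ‖e‖ ≤ 1 → |fderiv ℝ (ζ R) z e| ≤ L / R := by
    intro R z e hR he
    have h1 := (fderiv ℝ (ζ R) z).le_opNorm e
    rw [hfd, norm_smul, norm_inv, Real.norm_of_nonneg hR.le, ← hfd] at h1
    have h2 := hL (R⁻¹ • z)
    rw [Real.norm_eq_abs] at h1
    calc _ ≤ _ := h1
      _ ≤ R⁻¹ * L * 1 := by gcongr
      _ = L / R := by ring
  have hz0 : ∀ (f : R2 → ℝ) (c : ℝ) z, f =ᶠ[nhds z] (fun _ => c) → dx f z = 0 ∧ dy f z = 0 := by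
    intro f c z h
    have := h.fderiv_eq (𝕜 := ℝ)
    simp [dx, dy, this]
  refine ⟨ζ, L, hL0, hcd, hcs, fun R z => β.nonneg, fun R z => β.le_one, hone, hzero, ?_, ?_, ?_, ?_, ?_⟩
  · intro R z hR; exact hb R z _ hR (by simp [Prod.norm_def])
  · intro R z hR; exact hb R z _ hR (by simp [Prod.norm_def])
  · intro R z hR hz
    apply hz0 _ 1
    have : ∀ᶠ w : R2 in nhds z, ‖w‖ < R := continuous_norm.continuousAt.eventually_lt continuousAt_const hz
    filter_upwards [this] with w hw using hone R w hR hw.le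
  · intro R z hR hz
    apply hz0 _ 0
    have : ∀ᶠ w : R2 in nhds z, 2 * R < ‖w‖ := continuousAt_const.eventually_lt continuous_norm.continuousAt hz
    filter_upwards [this] with w hw using hzero R w hR hw.le
  · intro R hR
    have h1 : ∫ z, (ζ R z) ^ 2 ≤ ∫ z, (Metric.closedBall (0:R2) (2*R)).indicator (fun _ => (1:ℝ)) z := by
      apply integral_mono
      · have h := (hcs R hR)
        apply Continuous.integrable_of_hasCompactSupport
        · exact (hcd R).continuous.pow 2
        · exact h.comp_left (g := fun x : ℝ => x ^ 2) (by simp)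
      · rw [integrable_indicator_iff measurableSet_closedBall]
        exact integrableOn_const (isCompact_closedBall _ _).measure_lt_top.ne
      · intro z
        by_cases hz : z ∈ Metric.closedBall (0:R2) (2*R)
        · simp only [indicator_of_mem hz]
          exact pow_le_one₀ β.nonneg β.le_one
        · simp only [indicator_of_notMem hz]
          rw [mem_closedBall_zero_iff, not_le] at hz
          rw [hzero R z hR hz.le]; simp
    refine h1.trans (le_of_eq ?_)
    rw [integral_indicator measurableSet_closedBall]
    simp only [integral_const, smul_eq_mul, mul_one, MeasurableSet.univ, measureReal_restrict_apply, univ_inter]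
    have : Metric.closedBall (0:R2) (2*R) = Metric.closedBall (0:ℝ) (2*R) ×ˢ Metric.closedBall (0:ℝ) (2*R) := by
      rw [closedBall_prod_same]; rfl
    rw [this, Measure.volume_eq_prod, measureReal_def, Measure.prod_prod, ENNReal.toReal_mul, Real.volume_closedBall,
      ENNReal.toReal_ofReal (by linarith)]
    ring
structure EFlow (a b p : R2 → ℝ) (m M : ℝ) : Prop where
  ha : ContDiff ℝ 2 a
  hb : ContDiff ℝ 2 b
  hp : ContDiff ℝ 1 p
  e1 : ∀ z, dx p z = -(a z * dx a z + b z * dy a z)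
  e2 : ∀ z, dy p z = -(a z * dx b z + b z * dy b z)
  dv : ∀ z, dx a z + dy b z = 0
  mpos : 0 < m
  lo : ∀ z, m ≤ a z ^ 2 + b z ^ 2
  hi : ∀ z, a z ^ 2 + b z ^ 2 ≤ M

lemma pt_ineq {t X Y u α β N M : ℝ} (ht : 0 ≤ t) (ht1 : t ≤ 1) (h2 : |X| ≤ N) (h3 : |Y| ≤ N)
    (hr : α ^ 2 + β ^ 2 ≤ M) :
    t ^ 2 * u ^ 2 ≤ 2 * (t ^ 2 * ((u + β ^ 2) * (u + α ^ 2) - (α * β) ^ 2)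
      + 2 * t * (X * (u + α ^ 2) + Y * (α * β)))
      + 2 * (M ^ 2 + 4 * N ^ 2 + 4 * N * M) * 1 ^ 2 := by
  have e : t ^ 2 * ((u + β ^ 2) * (u + α ^ 2) - (α * β) ^ 2)
      + 2 * t * (X * (u + α ^ 2) + Y * (α * β))
    = (t * u) ^ 2 + (t * u) * (t * (α ^ 2 + β ^ 2)) + 2 * X * (t * u)
      + 2 * (t * (X * α ^ 2)) + 2 * (t * (Y * (α * β))) := by ring
  rw [e]
  have ba : α ^ 2 ≤ M := by linarith [sq_nonneg β]
  have hN0 : 0 ≤ N := (abs_nonneg X).trans h2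
  have bT : |α * β| ≤ M := by
    rw [abs_le]; constructor <;> nlinarith [sq_nonneg (α + β), sq_nonneg (α - β)]
  set r := α ^ 2 + β ^ 2
  have hr0 : 0 ≤ r := by positivity
  have i1 : (t * u) * (t * r) ≥ - ((t*u)^2/4 + M ^ 2) := by
    have : (t * r)^2 ≤ M ^ 2 := by
      apply pow_le_pow_left₀ (by positivity)
      exact (mul_le_of_le_one_left hr0 ht1).trans hr
    linarith [sq_nonneg (t * u / 2 + t * r), show (t * u / 2 + t * r) ^ 2 =
      (t * u) ^ 2 / 4 + (t * u) * (t * r) + (t * r) ^ 2 by ring]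
  have i2 : 2 * X * (t * u) ≥ - ((t*u)^2/4 + 4 * N ^ 2) := by
    have : X ^ 2 ≤ N ^ 2 := sq_le_sq' (abs_le.1 h2).1 (abs_le.1 h2).2
    linarith [sq_nonneg (t * u / 2 + 2 * X), show (t * u / 2 + 2 * X) ^ 2 =
      (t * u) ^ 2 / 4 + 2 * X * (t * u) + 4 * X ^ 2 by ring]
  have i3 : t * (X * α ^ 2) ≥ - (N * M) := by
    have : |t * (X * α ^ 2)| ≤ 1 * (N * M) := by
      rw [abs_mul, abs_mul, abs_of_nonneg ht, abs_of_nonneg (sq_nonneg α)]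
      gcongr
    have := (abs_le.1 this).1
    linarith
  have i4 : t * (Y * (α * β)) ≥ - (N * M) := by
    have : |t * (Y * (α * β))| ≤ 1 * (N * M) := by
      rw [abs_mul, abs_mul Y, abs_of_nonneg ht]
      gcongr
    have := (abs_le.1 this).1
    linarith
  have : t ^ 2 * u ^ 2 = (t * u) ^ 2 := by ring
  rw [this]
  linarith

set_option maxHeartbeats 1000000 in
lemma est_q {a b p : R2 → ℝ} {m M L : ℝ} {ζ : ℝ → R2 → ℝ} (F : EFlow a b p m M)
    (hζ : CutoffFam ζ L) (hL : 0 ≤ L) :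
    ∃ K, 0 ≤ K ∧ ∀ R, 0 < R → ∃ c, ∫ z, (ζ R z) ^ 2 * (p z - c) ^ 2 ≤ K * R ^ 2 := by
  have ha : ContDiff ℝ 1 a := F.ha.of_le (by norm_num)
  have hb : ContDiff ℝ 1 b := F.hb.of_le (by norm_num)
  have hp := F.hp
  have hM : 0 ≤ M := F.mpos.le.trans ((F.lo 0).trans (F.hi 0))
  let T : R2 → ℝ := fun z => a z * b z
  let A : R2 → ℝ := fun z => p z + a z * a z
  let B : R2 → ℝ := fun z => p z + b z * b z
  have hT : ContDiff ℝ 1 T := ha.mul hb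
  have hA : ContDiff ℝ 1 A := hp.add (ha.mul ha)
  have hB : ContDiff ℝ 1 B := hp.add (hb.mul hb)
  have hTx : ∀ z, dx T z = dx a z * b z + a z * dx b z := dx_mul ha hb
  have hTy : ∀ z, dy T z = dy a z * b z + a z * dy b z := dy_mul ha hb
  have hAx : ∀ z, dx A z = - dy T z := by
    intro z
    have h1 := dx_add hp (ha.mul ha) z
    have h2 := dx_mul ha ha z
    have h3 : dx A z = dx p z + (dx a z * a z + a z * dx a z) := by rw [← h2]; exact h1
    rw [h3, hTy, F.e1]
    linear_combination (a z) * F.dv z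
  have hBy : ∀ z, dy B z = dx (fun w => - T w) z := by
    intro z
    have h1 := dy_add hp (hb.mul hb) z
    have h2 := dy_mul hb hb z
    have h3 : dy B z = dy p z + (dy b z * b z + b z * dy b z) := by rw [← h2]; exact h1
    rw [h3, dx_neg, hTx, F.e2]
    linear_combination (b z) * F.dv z
  obtain ⟨G, hG, hGx, hGy⟩ := exists_potential hB hT.neg hBy
  have ba : ∀ z, a z ^ 2 ≤ M := fun z => by have := F.hi z; nlinarith [sq_nonneg (b z)]
  have bb : ∀ z, b z ^ 2 ≤ M := fun z => by have := F.hi z; nlinarith [sq_nonneg (a z)]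
  have bT : ∀ z, |T z| ≤ M := fun z => by
    have := F.hi z
    have e : T z = a z * b z := rfl
    rw [e, abs_le]; constructor <;> nlinarith [sq_nonneg (a z + b z), sq_nonneg (a z - b z)]
  have bAB : ∀ z, |B z - A z| ≤ M := fun z => by
    have e : B z - A z = b z ^ 2 - a z ^ 2 := by simp only [A, B]; ring
    rw [e, abs_le]; constructor <;> nlinarith [ba z, bb z, sq_nonneg (a z), sq_nonneg (b z)]
  -- the constant
  set N : ℝ := 8 * M * L with hN
  have hN0 : 0 ≤ N := by positivity
  set K₀ : ℝ := M ^ 2 + 4 * N ^ 2 + 4 * N * M with hK₀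
  have hK₀0 : 0 ≤ K₀ := by positivity
  refine ⟨128 * K₀, by positivity, fun R hR => ?_⟩
  obtain ⟨c, d, hcd⟩ := G_bound hT hA hB hG hGx hGy hAx bT bAB (S := 2 * R) (by linarith)
  refine ⟨c, ?_⟩
  let q : R2 → ℝ := fun z => G z - (c * z.1 + d)
  have hl : ContDiff ℝ 1 (fun z : R2 => c * z.1 + d) := by fun_prop
  have hq : ContDiff ℝ 1 q := hG.sub hl
  have hlx : ∀ z : R2, dx (fun z : R2 => c * z.1 + d) z = c := by
    intro z
    rw [dx_add (f := fun z : R2 => c * z.1) (g := fun _ => d) (by fun_prop) (by fun_prop),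
      dx_mul (f := fun _ => c) (g := fun z : R2 => z.1) (by fun_prop) (by fun_prop), dx_const, dx_const, dx_fst]
    ring
  have hly : ∀ z : R2, dy (fun z : R2 => c * z.1 + d) z = 0 := by
    intro z
    rw [dy_add (f := fun z : R2 => c * z.1) (g := fun _ => d) (by fun_prop) (by fun_prop),
      dy_mul (f := fun _ => c) (g := fun z : R2 => z.1) (by fun_prop) (by fun_prop), dy_const, dy_const, dy_fst]
    ring
  have hqx : ∀ z, dx q z = B z - c := fun z => by
    rw [show dx q z = _ from dx_sub hG hl z, hGx, hlx]
  have hqy : ∀ z, dy q z = - T z := fun z => by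
    rw [show dy q z = _ from dy_sub hG hl z, hGy, hly, sub_zero]
  let s : R2 → ℝ := ζ R
  have hs : ContDiff ℝ 1 s := hζ.cd R
  have hss : ContDiff ℝ 1 (fun z => s z * s z) := hs.mul hs
  have hssq : ContDiff ℝ 1 (fun z => (s z * s z) * q z) := hss.mul hq
  have hAc : ContDiff ℝ 1 (fun z => A z - c) := hA.sub contDiff_const
  let W1 : R2 → ℝ := fun z => ((s z * s z) * q z) * (A z - c)
  let W2 : R2 → ℝ := fun z => ((s z * s z) * q z) * T z
  have hW1 : ContDiff ℝ 1 W1 := hssq.mul hAc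
  have hW2 : ContDiff ℝ 1 W2 := hssq.mul hT
  have hsc : HasCompactSupport s := hζ.cs R hR
  have cW1 : HasCompactSupport W1 := by
    have : W1 = fun z => s z * (s z * q z * (A z - c)) := by ext z; simp only [W1]; ring
    rw [this]; exact hsc.mul_right
  have cW2 : HasCompactSupport W2 := by
    have : W2 = fun z => s z * (s z * q z * T z) := by ext z; simp only [W2]; ring
    rw [this]; exact hsc.mul_right
  have hdiv : ∀ z, dx W1 z + dy W2 z = (s z) ^ 2 * ((B z - c) * (A z - c) - T z ^ 2)
      + 2 * s z * q z * (dx s z * (A z - c) + dy s z * T z) := by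
    intro z
    rw [show dx W1 z = _ from dx_mul hssq hAc z, show dy W2 z = _ from dy_mul hssq hT z,
      dx_mul hss hq, dy_mul hss hq, dx_mul hs hs, dy_mul hs hs, hqx, hqy, dx_sub hA contDiff_const,
      dx_const, hAx]
    ring
  -- pointwise inequality
  have hpt : ∀ z, (s z) ^ 2 * (p z - c) ^ 2 ≤ 2 * (dx W1 z + dy W2 z) + 2 * K₀ * (ζ (2 * R) z) ^ 2 := by
    intro z
    rw [hdiv]
    by_cases hz : ‖z‖ ≤ 2 * R
    · rw [hζ.one (2 * R) z (by linarith) hz]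
      have hz1 : |z.1| ≤ 2 * R := (norm_fst_le z).trans hz
      have hz2 : |z.2| ≤ 2 * R := (norm_snd_le z).trans hz
      have h1 := hcd z hz1 hz2
      have h1' : |q z| ≤ 8 * M * R := by
        have : q z = G z - c * z.1 - d := by simp only [q]; ring
        rw [this]; linarith
      have hx := hζ.bx R z hR
      have hy := hζ.bdy R z hR
      have h2 : |q z * dx s z| ≤ N := by
        rw [abs_mul]
        calc _ ≤ (8 * M * R) * (L / R) := by gcongr
          _ = N := by rw [hN]; field_simp
      have h3 : |q z * dy s z| ≤ N := by
        rw [abs_mul]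
        calc _ ≤ (8 * M * R) * (L / R) := by gcongr
          _ = N := by rw [hN]; field_simp
      have h0 := hζ.nonneg R z
      have h0' := hζ.le_one R z
      have key := pt_ineq (t := s z) (X := q z * dx s z) (Y := q z * dy s z) (u := p z - c)
        (α := a z) (β := b z) h0 h0' h2 h3 (F.hi z)
      have e : s z ^ 2 * ((B z - c) * (A z - c) - T z ^ 2)
          + 2 * s z * q z * (dx s z * (A z - c) + dy s z * T z)
        = s z ^ 2 * (((p z - c) + b z ^ 2) * ((p z - c) + a z ^ 2) - (a z * b z) ^ 2)
          + 2 * s z * ((q z * dx s z) * ((p z - c) + a z ^ 2) + (q z * dy s z) * (a z * b z)) := by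
        have eA : A z = p z + a z * a z := rfl
        have eB : B z = p z + b z * b z := rfl
        have eT : T z = a z * b z := rfl
        rw [eA, eB, eT]; ring
      rw [e, hK₀]
      linarith
    · have : s z = 0 := hζ.zero R z hR (not_le.1 hz).le
      rw [this]
      have : 0 ≤ 2 * K₀ * (ζ (2 * R) z) ^ 2 := by positivity
      linarith
  obtain ⟨iW1, zW1⟩ := integral_fderiv_zero hW1 cW1 (1, 0)
  obtain ⟨iW2, zW2⟩ := integral_fderiv_zero hW2 cW2 (0, 1)
  have i3 : Integrable (fun z => (ζ (2 * R) z) ^ 2) :=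
    Continuous.integrable_of_hasCompactSupport (f := fun z => (ζ (2 * R) z) ^ 2)
      ((hζ.cd (2 * R)).continuous.pow 2)
      ((hζ.cs (2 * R) (by linarith)).comp_left (g := fun x : ℝ => x ^ 2) (by simp))
  have i0 : Integrable (fun z => (s z) ^ 2 * (p z - c) ^ 2) := by
    apply Continuous.integrable_of_hasCompactSupport
    · have := hs.continuous; have := hp.continuous; fun_prop
    · have : (fun z => (s z) ^ 2 * (p z - c) ^ 2) = fun z => s z * (s z * (p z - c) ^ 2) := by
        ext z; ring
      rw [this]; exact hsc.mul_right
  have := integral_mono i0 (((iW1.add iW2).const_mul 2).add (i3.const_mul (2 * K₀))) hpt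
  refine this.trans ?_
  have e1 := integral_add' ((iW1.add iW2).const_mul 2) (i3.const_mul (2 * K₀))
  rw [integral_const_mul, integral_add' iW1 iW2, zW1, zW2, integral_const_mul] at e1
  refine e1.le.trans ?_
  have := hζ.int (2 * R) (by linarith)
  calc _ = 2 * K₀ * ∫ z, (ζ (2 * R) z) ^ 2 := by ring
    _ ≤ 2 * K₀ * (16 * (2 * R) ^ 2) := by gcongr
    _ = _ := by ring
lemma EFlow.div_free {a b p : R2 → ℝ} {m M : ℝ} (F : EFlow a b p m M) :
    ∃ Q1 Q2 I : R2 → ℝ, ContDiff ℝ 1 Q1 ∧ ContDiff ℝ 1 Q2 ∧ Continuous I ∧ (∀ z, 0 < I z) ∧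
      (∀ z, I z ≤ m⁻¹) ∧ (∀ z, Q1 z = dx p z * I z) ∧ (∀ z, Q2 z = dy p z * I z) ∧
      ∀ z, dx Q1 z + dy Q2 z = 0 := by
  have ha : ContDiff ℝ 1 a := F.ha.of_le (by norm_num)
  have hb : ContDiff ℝ 1 b := F.hb.of_le (by norm_num)
  have hax := c1_dx F.ha
  have hay := c1_dy F.ha
  have hbx := c1_dx F.hb
  have hby := c1_dy F.hb
  have hpos : ∀ z, 0 < a z * a z + b z * b z := fun z => by
    have := F.lo z; have := F.mpos; nlinarith
  have haa := ha.mul ha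
  have hbb := hb.mul hb
  let ρ : R2 → ℝ := fun z => a z * a z + b z * b z
  have hρ : ContDiff ℝ 1 ρ := haa.add hbb
  let I : R2 → ℝ := fun z => (ρ z)⁻¹
  have hI : ContDiff ℝ 1 I := hρ.inv (fun z => (hpos z).ne')
  have hIρ : ∀ z, I z * ρ z = 1 := fun z => inv_mul_cancel₀ (hpos z).ne'
  have hIx : ∀ z, dx I z * ρ z + I z * dx ρ z = 0 := by
    intro z
    rw [← dx_mul hI hρ]
    have : (fun w => I w * ρ w) = fun _ => 1 := funext hIρ
    rw [this, dx_const]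
  have hIy : ∀ z, dy I z * ρ z + I z * dy ρ z = 0 := by
    intro z
    rw [← dy_mul hI hρ]
    have : (fun w => I w * ρ w) = fun _ => 1 := funext hIρ
    rw [this, dy_const]
  have hρx : ∀ z, dx ρ z = 2 * (a z * dx a z + b z * dx b z) := by
    intro z
    rw [show dx ρ z = _ from dx_add haa hbb z, dx_mul ha ha, dx_mul hb hb]; ring
  have hρy : ∀ z, dy ρ z = 2 * (a z * dy a z + b z * dy b z) := by
    intro z
    rw [show dy ρ z = _ from dy_add haa hbb z, dy_mul ha ha, dy_mul hb hb]; ring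
  let N1 : R2 → ℝ := fun z => a z * dy b z - b z * dy a z
  let N2 : R2 → ℝ := fun z => b z * dx a z - a z * dx b z
  have h11 := ha.mul hby
  have h12 := hb.mul hay
  have h21 := hb.mul hax
  have h22 := ha.mul hbx
  have hN1 : ContDiff ℝ 1 N1 := h11.sub h12
  have hN2 : ContDiff ℝ 1 N2 := h21.sub h22
  refine ⟨fun z => N1 z * I z, fun z => N2 z * I z, I, hN1.mul hI, hN2.mul hI, hI.continuous,
    fun z => inv_pos.2 (hpos z), fun z => ?_, fun z => ?_, fun z => ?_, fun z => ?_⟩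
  · apply inv_anti₀ F.mpos
    have := F.lo z
    simp only [ρ]; nlinarith
  · have : dx p z = N1 z := by
      rw [F.e1]; simp only [N1]; linear_combination (-a z) * F.dv z
    rw [this]
  · have : dy p z = N2 z := by
      rw [F.e2]; simp only [N2]; linear_combination (-b z) * F.dv z
    rw [this]
  · rw [dx_mul hN1 hI, dy_mul hN2 hI, show dx N1 z = _ from dx_sub h11 h12 z,
      show dy N2 z = _ from dy_sub h21 h22 z, dx_mul ha hby, dx_mul hb hay, dy_mul hb hax, dy_mul ha hbx,
      dx_dy_comm F.ha, dx_dy_comm F.hb]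
    have k1 := hIx z
    have k2 := hIy z
    have k3 := hIρ z
    rw [hρx] at k1
    rw [hρy] at k2
    have l1 : dx I z = - I z * I z * (2 * (a z * dx a z + b z * dx b z)) := by
      linear_combination (I z) * k1 - dx I z * k3
    have l2 : dy I z = - I z * I z * (2 * (a z * dy a z + b z * dy b z)) := by
      linear_combination (I z) * k2 - dy I z * k3
    rw [l1, l2]
    simp only [N1, N2]
    simp only [ρ] at k3
    linear_combination (-2 * I z * (dx a z * dy b z - dy a z * dx b z)) * k3

lemma pressure_const {a b p : R2 → ℝ} {m M : ℝ} (F : EFlow a b p m M) (z : R2) :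
    dx p z = 0 ∧ dy p z = 0 := by
  obtain ⟨ζ, L, hL, hζ⟩ := exists_cutoff
  obtain ⟨K, hK, hKq⟩ := est_q F hζ hL
  obtain ⟨Q1, Q2, I, hQ1, hQ2, cI, Ipos, Ile, eQ1, eQ2, hdivQ⟩ := F.div_free
  have hp := F.hp
  have cpx := cont_dx hp
  have cpy := cont_dy hp
  have cp := hp.continuous
  let w : R2 → ℝ := fun z => (dx p z ^ 2 + dy p z ^ 2) * I z
  have cw : Continuous w := by fun_prop
  have wnn : ∀ z, 0 ≤ w z := fun z => mul_nonneg (by positivity) (Ipos z).le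
  have integ : ∀ R, 0 < R → ∀ f : R2 → ℝ, Continuous f → Integrable (fun z => (ζ R z) ^ 2 * f z) := by
    intro R hR f hf
    apply Continuous.integrable_of_hasCompactSupport
    · have := (hζ.cd R).continuous; fun_prop
    · have : (fun z => (ζ R z) ^ 2 * f z) = fun z => ζ R z * (ζ R z * f z) := by
        ext z; ring
      rw [this]; exact (hζ.cs R hR).mul_right
  let X : ℝ → ℝ := fun R => ∫ z, (ζ R z) ^ 2 * w z
  set K' : ℝ := 8 * L ^ 2 * m⁻¹ * K with hK'
  have mi : 0 < m⁻¹ := inv_pos.2 F.mpos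
  have hK'0 : 0 ≤ K' := by positivity
  -- basic identity and estimate
  have key : ∀ R, 0 < R → ∃ c, (∫ z, (ζ (2 * R) z) ^ 2 * (p z - c) ^ 2 ≤ 4 * K * R ^ 2) ∧
      ∃ D : R2 → ℝ, Integrable D ∧ ∫ z, D z = 0 ∧
      ∀ z, D z = (ζ R z) ^ 2 * w z + 2 * ζ R z * (p z - c) * I z * (dx p z * dx (ζ R) z + dy p z * dy (ζ R) z) := by
    intro R hR
    obtain ⟨c, hc⟩ := hKq (2 * R) (by linarith)
    refine ⟨c, by linarith, ?_⟩
    let s : R2 → ℝ := ζ R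
    have hs : ContDiff ℝ 1 s := hζ.cd R
    have hsc : HasCompactSupport s := hζ.cs R hR
    have hss := hs.mul hs
    have hq : ContDiff ℝ 1 (fun z => p z - c) := hp.sub contDiff_const
    have hssq := hss.mul hq
    let W1 : R2 → ℝ := fun z => ((s z * s z) * (p z - c)) * Q1 z
    let W2 : R2 → ℝ := fun z => ((s z * s z) * (p z - c)) * Q2 z
    have hW1 : ContDiff ℝ 1 W1 := hssq.mul hQ1
    have hW2 : ContDiff ℝ 1 W2 := hssq.mul hQ2
    have cW1 : HasCompactSupport W1 := by
      have : W1 = fun z => s z * (s z * (p z - c) * Q1 z) := by ext z; simp only [W1]; ring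
      rw [this]; exact hsc.mul_right
    have cW2 : HasCompactSupport W2 := by
      have : W2 = fun z => s z * (s z * (p z - c) * Q2 z) := by ext z; simp only [W2]; ring
      rw [this]; exact hsc.mul_right
    obtain ⟨iW1, zW1⟩ := integral_fderiv_zero hW1 cW1 (1, 0)
    obtain ⟨iW2, zW2⟩ := integral_fderiv_zero hW2 cW2 (0, 1)
    refine ⟨_, iW1.add iW2, ?_, fun z => ?_⟩
    · rw [integral_add' iW1 iW2, zW1, zW2, add_zero]
    · change dx W1 z + dy W2 z = _
      rw [show dx W1 z = _ from dx_mul hssq hQ1 z, show dy W2 z = _ from dy_mul hssq hQ2 z,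
        dx_mul hss hq, dy_mul hss hq, dx_mul hs hs, dy_mul hs hs, dx_sub hp contDiff_const,
        dy_sub hp contDiff_const, dx_const, dy_const]
      have := hdivQ z
      have k1 := eQ1 z
      have k2 := eQ2 z
      simp only [w]
      rw [k1, k2]
      linear_combination (s z * s z * (p z - c)) * this
  -- gradient of cutoff estimate
  have gz : ∀ R, 0 < R → ∀ z t, t ^ 2 * I z * (dx (ζ R) z ^ 2 + dy (ζ R) z ^ 2) ≤
      (2 * L ^ 2 * m⁻¹ / R ^ 2) * ((ζ (2 * R) z) ^ 2 * t ^ 2) := by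
    intro R hR z t
    by_cases hz : ‖z‖ ≤ 2 * R
    · rw [hζ.one (2 * R) z (by linarith) hz]
      have h1 : dx (ζ R) z ^ 2 ≤ (L / R) ^ 2 := sq_le_sq' (abs_le.1 (hζ.bx R z hR)).1 (abs_le.1 (hζ.bx R z hR)).2
      have h2 : dy (ζ R) z ^ 2 ≤ (L / R) ^ 2 := sq_le_sq' (abs_le.1 (hζ.bdy R z hR)).1 (abs_le.1 (hζ.bdy R z hR)).2
      have h3 := Ile z
      have h4 := Ipos z
      calc _ ≤ t ^ 2 * m⁻¹ * ((L / R) ^ 2 + (L / R) ^ 2) := by gcongr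
        _ = _ := by field_simp; ring
    · obtain ⟨h1, h2⟩ := hζ.out0 R z hR (not_le.1 hz)
      rw [h1, h2]
      have : 0 ≤ (2 * L ^ 2 * m⁻¹ / R ^ 2) * ((ζ (2 * R) z) ^ 2 * t ^ 2) := by positivity
      simpa using this
  -- Cauchy-Schwarz
  have cs : ∀ (x y u v k : ℝ) (l : ℝ), 0 < l → 0 ≤ k → -(2 * k * (x * u + y * v)) ≤ l * (k * (x ^ 2 + y ^ 2)) + l⁻¹ * (k * (u ^ 2 + v ^ 2)) := by
    intro x y u v k l hl hk
    have e : l * (k * (x ^ 2 + y ^ 2)) + l⁻¹ * (k * (u ^ 2 + v ^ 2)) + 2 * k * (x * u + y * v)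
      = k * l⁻¹ * ((l * x + u) ^ 2 + (l * y + v) ^ 2) := by field_simp; ring
    have : 0 ≤ k * l⁻¹ * ((l * x + u) ^ 2 + (l * y + v) ^ 2) := by positivity
    linarith
  have Xbdd : ∀ R, 0 < R → X R ≤ 4 * K' := by
    intro R hR
    obtain ⟨c, hc, D, iD, zD, hD⟩ := key R hR
    have pt : ∀ z, (ζ R z) ^ 2 * w z ≤ 2 * D z + (4 * (2 * L ^ 2 * m⁻¹ / R ^ 2)) * ((ζ (2 * R) z) ^ 2 * (p z - c) ^ 2) := by
      intro z
      rw [hD]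
      have h1 := cs ((p z - c) * dx (ζ R) z) ((p z - c) * dy (ζ R) z) (ζ R z * dx p z) (ζ R z * dy p z) (I z) 2 two_pos (Ipos z).le
      have h2 := gz R hR z (p z - c)
      simp only [w]
      nlinarith
    have i2 := integ (2 * R) (by linarith) (fun z => (p z - c) ^ 2) (by fun_prop)
    have := integral_mono (integ R hR w cw) ((iD.const_mul 2).add (i2.const_mul (4 * (2 * L ^ 2 * m⁻¹ / R ^ 2)))) pt
    rw [integral_add' (iD.const_mul 2) (i2.const_mul _), integral_const_mul, integral_const_mul, zD] at this
    calc X R ≤ _ := this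
      _ ≤ 2 * 0 + 4 * (2 * L ^ 2 * m⁻¹ / R ^ 2) * (4 * K * R ^ 2) := by gcongr
      _ = 4 * K' := by rw [hK']; field_simp; ring
  have mono : ∀ R z, 0 < R → (ζ R z) ^ 2 ≤ (ζ (2 * R) z) ^ 2 := by
    intro R z hR
    apply pow_le_pow_left₀ (hζ.nonneg _ _)
    by_cases hz : ‖z‖ ≤ 2 * R
    · rw [hζ.one (2 * R) z (by linarith) hz]; exact hζ.le_one _ _
    · rw [hζ.zero R z hR (not_le.1 hz).le]; exact hζ.nonneg _ _
  have Xmono : ∀ R, 0 < R → X R ≤ X (2 * R) := by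
    intro R hR
    apply integral_mono (integ R hR w cw) (integ (2 * R) (by linarith) w cw)
    intro z
    exact mul_le_mul_of_nonneg_right (mono R z hR) (wnn z)
  have Xstep : ∀ R, 0 < R → ∀ l, 0 < l → X (2 * R) ≤ l * K' + l⁻¹ * (X (2 * (2 * R)) - X R) := by
    intro R hR l hl
    set S := 2 * R with hS
    have hS0 : 0 < S := by linarith
    obtain ⟨c, hc, D, iD, zD, hD⟩ := key S hS0
    have pt : ∀ z, (ζ S z) ^ 2 * w z ≤ (D z + (l * (2 * L ^ 2 * m⁻¹ / S ^ 2)) * ((ζ (2 * S) z) ^ 2 * (p z - c) ^ 2))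
        + l⁻¹ * ((ζ (2 * S) z) ^ 2 * w z - (ζ R z) ^ 2 * w z) := by
      intro z
      have hl' : 0 < l⁻¹ := inv_pos.2 hl
      have mm : 0 ≤ l⁻¹ * ((ζ (2 * S) z) ^ 2 * w z - (ζ R z) ^ 2 * w z) := by
        have h1 := (mono R z hR).trans (mono S z hS0)
        have := wnn z
        apply mul_nonneg hl'.le
        nlinarith
      have nn2 : 0 ≤ (l * (2 * L ^ 2 * m⁻¹ / S ^ 2)) * ((ζ (2 * S) z) ^ 2 * (p z - c) ^ 2) := by positivity
      rw [hD]
      by_cases hz1 : ‖z‖ < S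
      · obtain ⟨h1, h2⟩ := hζ.in0 S z hS0 hz1
        rw [h1, h2]; simp only [mul_zero, add_zero]; linarith
      by_cases hz2 : 2 * S < ‖z‖
      · obtain ⟨h1, h2⟩ := hζ.out0 S z hS0 hz2
        rw [h1, h2]; simp only [mul_zero, add_zero]; linarith
      rw [hζ.zero R z hR (not_lt.1 hz1)]
      have h1 := cs ((p z - c) * dx (ζ S) z) ((p z - c) * dy (ζ S) z) (ζ S z * dx p z) (ζ S z * dy p z) (I z) l hl (Ipos z).le
      have h2 := mul_le_mul_of_nonneg_left (gz S hS0 z (p z - c)) hl.le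
      rw [hζ.one (2 * S) z (by linarith) (not_lt.1 hz2)] at h2 ⊢
      have h3 : l⁻¹ * ((ζ S z) ^ 2 * w z) ≤ l⁻¹ * w z := by
        have : (ζ S z) ^ 2 ≤ 1 := pow_le_one₀ (hζ.nonneg _ _) (hζ.le_one _ _)
        have := wnn z
        apply mul_le_mul_of_nonneg_left _ hl'.le
        nlinarith
      have e : l⁻¹ * (I z * ((ζ S z * dx p z) ^ 2 + (ζ S z * dy p z) ^ 2)) = l⁻¹ * ((ζ S z) ^ 2 * w z) := by
        simp only [w]; ring
      rw [e] at h1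
      linarith
    have i2 := integ (2 * S) (by linarith) (fun z => (p z - c) ^ 2) (by fun_prop)
    have i3 := integ (2 * S) (by linarith) w cw
    have i4 := integ R hR w cw
    have := integral_mono (integ S hS0 w cw) ((iD.add (i2.const_mul (l * (2 * L ^ 2 * m⁻¹ / S ^ 2)))).add ((i3.sub i4).const_mul l⁻¹)) pt
    rw [integral_add' (iD.add (i2.const_mul _)) ((i3.sub i4).const_mul _), integral_add' iD (i2.const_mul _),
      integral_const_mul, integral_const_mul, integral_sub' i3 i4, zD] at this
    calc X S ≤ _ := this
      _ ≤ 0 + (l * (2 * L ^ 2 * m⁻¹ / S ^ 2)) * (4 * K * S ^ 2) + l⁻¹ * (X (2 * S) - X R) := by gcongr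
      _ = _ := by rw [hK']; field_simp; ring
  -- the limit
  let x : ℕ → ℝ := fun n => X (2 ^ n)
  have xs : ∀ n, X (2 * 2 ^ n) = x (n + 1) := fun n => by simp only [x, pow_succ']
  have xmono : Monotone x := monotone_nat_of_le_succ fun n => by
    rw [← xs]; exact Xmono _ (by positivity)
  have xlim : Tendsto x atTop (nhds (⨆ n, x n)) :=
    tendsto_atTop_ciSup xmono ⟨4 * K', by rintro _ ⟨n, rfl⟩; exact Xbdd _ (by positivity)⟩
  set Y := ⨆ n, x n
  have hY : ∀ l, 0 < l → Y ≤ l * K' := by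
    intro l hl
    have t1 : Tendsto (fun n => x (n + 1)) atTop (nhds Y) := (tendsto_add_atTop_iff_nat 1).2 xlim
    have t2 : Tendsto (fun n => x (n + 2)) atTop (nhds Y) := (tendsto_add_atTop_iff_nat 2).2 xlim
    have t3 : Tendsto (fun n => l * K' + l⁻¹ * (x (n + 2) - x n)) atTop (nhds (l * K' + l⁻¹ * (Y - Y))) :=
      ((t2.sub xlim).const_mul l⁻¹).const_add (l * K')
    have := le_of_tendsto_of_tendsto' t1 t3 (fun n => by
      have := Xstep (2 ^ n) (by positivity) l hl
      rw [xs] at this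
      have e : (2 : ℝ) * (2 * 2 ^ n) = 2 ^ (n + 2) := by ring
      rw [e] at this
      exact this)
    simpa using this
  have hY0 : Y ≤ 0 := by
    by_contra h
    push Not at h
    have := hY (Y / (2 * (K' + 1))) (by positivity)
    have h2 : Y / (2 * (K' + 1)) * K' < Y := by
      rw [div_mul_eq_mul_div, div_lt_iff₀ (by positivity)]
      nlinarith
    linarith
  obtain ⟨n, hn⟩ := pow_unbounded_of_one_lt ‖z‖ (one_lt_two (α := ℝ))
  have hxn : x n ≤ 0 := (xmono.ge_of_tendsto xlim n).trans hY0
  have hxn0 : ∫ z, (ζ (2 ^ n) z) ^ 2 * w z = 0 :=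
    le_antisymm hxn (integral_nonneg fun z => mul_nonneg (sq_nonneg _) (wnn z))
  have hcont : Continuous (fun z => (ζ (2 ^ n) z) ^ 2 * w z) := by
    have := (hζ.cd (2 ^ n)).continuous; fun_prop
  have hae := (integral_eq_zero_iff_of_nonneg (fun z => mul_nonneg (sq_nonneg _) (wnn z))
    (integ (2 ^ n) (by positivity) w cw)).1 hxn0
  have hz := congrFun ((hcont.ae_eq_iff_eq volume continuous_const).1 hae) z
  rw [hζ.one (2 ^ n) z (by positivity) hn.le] at hz
  simp only [w, Pi.zero_apply, one_pow, one_mul] at hz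
  have h0 : dx p z ^ 2 + dy p z ^ 2 = 0 := (mul_eq_zero.1 hz).resolve_right (Ipos z).ne'
  constructor <;> nlinarith [sq_nonneg (dx p z), sq_nonneg (dy p z)]

lemma fderiv_dxdy (f : R2 → ℝ) (z w : R2) : fderiv ℝ f z w = w.1 * dx f z + w.2 * dy f z := by
  have : w = w.1 • ((1, 0) : R2) + w.2 • ((0, 1) : R2) := by ext <;> simp
  conv_lhs => rw [this]
  rw [map_add, map_smul, map_smul]; rfl

lemma const_of_dxdy {f : R2 → ℝ} (hf : ContDiff ℝ 1 f) (hx : ∀ z, dx f z = 0)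
    (hy : ∀ z, dy f z = 0) (z w : R2) : f z = f w := by
  apply is_const_of_fderiv_eq_zero (𝕜 := ℝ) (hf.differentiable one_ne_zero)
  intro z
  ext1
  all_goals
    ext
    simp [fderiv_dxdy, hx, hy]

lemma shear_R2 {a b p : R2 → ℝ} {m M : ℝ} (F : EFlow a b p m M) :
    ∃ e1 e2 : ℝ, e1 ^ 2 + e2 ^ 2 = 1 ∧ ∃ V : ℝ → ℝ, Continuous V ∧ (∀ s, 0 < V s) ∧
      ∀ z : R2, a z = V (z.2 * e1 - z.1 * e2) * e1 ∧ b z = V (z.2 * e1 - z.1 * e2) * e2 := by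
  have ha : ContDiff ℝ 1 a := F.ha.of_le (by norm_num)
  have hb : ContDiff ℝ 1 b := F.hb.of_le (by norm_num)
  have hρ : ∀ z, 0 < a z ^ 2 + b z ^ 2 := fun z => F.mpos.trans_le (F.lo z)
  let n : R2 → ℝ := fun z => Real.sqrt (a z ^ 2 + b z ^ 2)
  have hn : ContDiff ℝ 1 n := ContDiff.sqrt ((ha.pow 2).add (hb.pow 2)) (fun z => (hρ z).ne')
  have npos : ∀ z, 0 < n z := fun z => Real.sqrt_pos.2 (hρ z)
  have nn : ∀ z, n z * n z = a z * a z + b z * b z := fun z => by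
    rw [show n z * n z = _ from Real.mul_self_sqrt (hρ z).le]; ring
  let α : R2 → ℝ := fun z => a z / n z
  let β : R2 → ℝ := fun z => b z / n z
  have hα : ContDiff ℝ 1 α := ha.div hn (fun z => (npos z).ne')
  have hβ : ContDiff ℝ 1 β := hb.div hn (fun z => (npos z).ne')
  have aα : ∀ z, a z = α z * n z := fun z => by
    have := (npos z).ne'
    simp only [α]; field_simp
  have bβ : ∀ z, b z = β z * n z := fun z => by
    have := (npos z).ne'
    simp only [β]; field_simp
  have aα' : a = fun z => α z * n z := funext aα
  have bβ' : b = fun z => β z * n z := funext bβ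
  have nn' : (fun z => n z * n z) = fun z => a z * a z + b z * b z := funext nn
  have nx : ∀ z, n z * dx n z = a z * dx a z + b z * dx b z := fun z => by
    have h : dx (fun z => n z * n z) z = dx (fun z => a z * a z + b z * b z) z := congrArg (fun f => dx f z) nn'
    rw [dx_mul hn hn, dx_add (ha.mul ha) (hb.mul hb), dx_mul ha ha, dx_mul hb hb] at h
    linarith
  have ny : ∀ z, n z * dy n z = a z * dy a z + b z * dy b z := fun z => by
    have h : dy (fun z => n z * n z) z = dy (fun z => a z * a z + b z * b z) z := congrArg (fun f => dy f z) nn'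
    rw [dy_mul hn hn, dy_add (ha.mul ha) (hb.mul hb), dy_mul ha ha, dy_mul hb hb] at h
    linarith
  have ax : ∀ z, dx a z = dx α z * n z + α z * dx n z := fun z => by
    conv_lhs => rw [aα']
    exact dx_mul hα hn z
  have ay : ∀ z, dy a z = dy α z * n z + α z * dy n z := fun z => by
    conv_lhs => rw [aα']
    exact dy_mul hα hn z
  have bx : ∀ z, dx b z = dx β z * n z + β z * dx n z := fun z => by
    conv_lhs => rw [bβ']
    exact dx_mul hβ hn z
  have bry : ∀ z, dy b z = dy β z * n z + β z * dy n z := fun z => by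
    conv_lhs => rw [bβ']
    exact dy_mul hβ hn z
  have cx : ∀ z, b z * dx a z - a z * dx b z = 0 := fun z => by
    have h1 := (pressure_const F z).2
    rw [F.e2] at h1
    linear_combination h1 + b z * F.dv z
  have cy : ∀ z, b z * dy a z - a z * dy b z = 0 := fun z => by
    have h1 := (pressure_const F z).1
    rw [F.e1] at h1
    linear_combination -h1 - a z * F.dv z
  have gen : ∀ (A B N α' Ax Bx Nx αx : ℝ), 0 < N → N * N = A * A + B * B → A = α' * N →
      N * Nx = A * Ax + B * Bx → Ax = αx * N + α' * Nx → B * Ax - A * Bx = 0 → αx = 0 := by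
    intro A B N α' Ax Bx Nx αx hN h1 h2 h3 h4 h5
    have : (N * N * N) * αx = 0 := by
      linear_combination (-N * N) * h4 + Ax * h1 - A * h3 + (Nx * N) * h2 + B * h5
    exact (mul_eq_zero.1 this).resolve_left (by positivity)
  have αx : ∀ z, dx α z = 0 := fun z =>
    gen _ _ _ _ _ _ _ _ (npos z) (nn z) (aα z) (nx z) (ax z) (cx z)
  have αy : ∀ z, dy α z = 0 := fun z =>
    gen _ _ _ _ _ _ _ _ (npos z) (nn z) (aα z) (ny z) (ay z) (cy z)
  have βx : ∀ z, dx β z = 0 := fun z =>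
    gen _ _ _ _ _ _ _ _ (npos z) ((nn z).trans (add_comm _ _)) (bβ z)
      ((nx z).trans (add_comm _ _)) (bx z) (by linarith [cx z])
  have βy : ∀ z, dy β z = 0 := fun z =>
    gen _ _ _ _ _ _ _ _ (npos z) ((nn z).trans (add_comm _ _)) (bβ z)
      ((ny z).trans (add_comm _ _)) (bry z) (by linarith [cy z])
  set e1 := α 0 with he1
  set e2 := β 0 with he2
  have hαc : ∀ z, α z = e1 := fun z => const_of_dxdy hα αx αy z 0
  have hβc : ∀ z, β z = e2 := fun z => const_of_dxdy hβ βx βy z 0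
  have hone : e1 ^ 2 + e2 ^ 2 = 1 := by
    have h := nn 0
    rw [aα 0, bβ 0, ← he1, ← he2] at h
    have h2 := npos 0
    have : (n 0 * n 0) * (e1 ^ 2 + e2 ^ 2 - 1) = 0 := by linear_combination -h
    have := (mul_eq_zero.1 this).resolve_left (by positivity)
    linarith
  have hdir : ∀ z, e1 * dx n z + e2 * dy n z = 0 := fun z => by
    have := F.dv z
    rw [ax, bry, αx, βy, hαc, hβc] at this
    linarith
  have hline : ∀ (z : R2) (t : ℝ), n (z + t • ((e1, e2) : R2)) = n z := by
    intro z t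
    have hd : ∀ t : ℝ, HasDerivAt (fun t : ℝ => n (z + t • ((e1, e2) : R2))) 0 t := by
      intro t
      have h1 : HasDerivAt (fun t : ℝ => z + t • ((e1, e2) : R2)) (e1, e2) t := by
        have := ((hasDerivAt_id t).smul_const ((e1, e2) : R2)).const_add z
        simpa using this
      have h2 := (hn.differentiable one_ne_zero (z + t • ((e1, e2) : R2))).hasFDerivAt
      have h3 := h2.comp_hasDerivAt t h1
      rw [fderiv_dxdy, hdir] at h3
      exact h3
    have := is_const_of_deriv_eq_zero (fun t => (hd t).differentiableAt) (fun t => (hd t).deriv) t 0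
    simpa using this
  refine ⟨e1, e2, hone, fun s => n (s * (-e2), s * e1), ?_, fun s => npos _, fun z => ?_⟩
  · have := hn.continuous
    fun_prop
  · have hz : n ((z.2 * e1 - z.1 * e2) * (-e2), (z.2 * e1 - z.1 * e2) * e1) = n z := by
      rw [← hline z (-(z.1 * e1 + z.2 * e2))]
      congr 1
      ext
      · simp only [Prod.fst_add, Prod.smul_fst, smul_eq_mul]
        linear_combination z.1 * hone
      · simp only [Prod.snd_add, Prod.smul_snd, smul_eq_mul]
        linear_combination z.2 * hone
    beta_reduce
    constructor
    · rw [hz, aα z, hαc]; ring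
    · rw [hz, bβ z, hβc]; ring

def Lm : R2 →L[ℝ] V2 :=
  (ContinuousLinearMap.fst ℝ ℝ ℝ).smulRight (EuclideanSpace.single 0 1) +
  (ContinuousLinearMap.snd ℝ ℝ ℝ).smulRight (EuclideanSpace.single 1 1)

lemma Lm_zero (z : R2) : Lm z 0 = z.1 := by simp [Lm]
lemma Lm_one (z : R2) : Lm z 1 = z.2 := by simp [Lm]
lemma Lm_10 : Lm (1, 0) = EuclideanSpace.single 0 1 := by simp [Lm]
lemma Lm_01 : Lm (0, 1) = EuclideanSpace.single 1 1 := by simp [Lm]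

lemma fderiv_coord {v : V2 → V2} (hv : ContDiff ℝ 2 v) (i : Fin 2) (z w : R2) :
    fderiv ℝ (fun z => v (Lm z) i) z w = fderiv ℝ v (Lm z) (Lm w) i := by
  have h1 := (hv.differentiable (by norm_num) (Lm z)).hasFDerivAt
  have h2 := h1.comp z Lm.hasFDerivAt
  have h3 := ((EuclideanSpace.proj i : V2 →L[ℝ] ℝ).hasFDerivAt
    (x := v (Lm z))).comp z h2
  have h4 : HasFDerivAt (fun z => v (Lm z) i) _ z := h3
  rw [h4.fderiv]
  rfl

lemma fderiv_p {p : V2 → ℝ} (hp : ContDiff ℝ 1 p) (z w : R2) :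
    fderiv ℝ (fun z => p (Lm z)) z w = fderiv ℝ p (Lm z) (Lm w) := by
  have h1 := (hp.differentiable (by norm_num) (Lm z)).hasFDerivAt
  have h2 : HasFDerivAt (fun z => p (Lm z)) _ z := h1.comp z Lm.hasFDerivAt
  rw [h2.fderiv]
  rfl

lemma grad_coord (p : V2 → ℝ) (x : V2) (i : Fin 2) :
    gradient p x i = fderiv ℝ p x (EuclideanSpace.single i 1) := by
  have : inner ℝ (gradient p x) (EuclideanSpace.single i 1) = fderiv ℝ p x (EuclideanSpace.single i 1) := by
    rw [gradient, InnerProductSpace.toDual_symm_apply]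
  rw [← this, EuclideanSpace.inner_single_right]
  simp


theorem stmt_18 (v : V2 → V2) (p : V2 → ℝ) (hv : ContDiff ℝ 2 v) (hp : ContDiff ℝ 1 p)
    (h : IsEuler v p) (C : ℝ) (hb : ∀ x, ‖v x‖ ≤ C)
    (η : ℝ) (hη : 0 < η) (hlow : ∀ x, η ≤ ‖v x‖) :
    ∃ e : V2, ‖e‖ = 1 ∧ ∃ V : ℝ → ℝ, Continuous V ∧
      ((∀ s, 0 < V s) ∨ (∀ s, V s < 0)) ∧
      ∀ x, v x = V (x 1 * e 0 - x 0 * e 1) • e := by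
  have nsq : ∀ x : V2, x 0 ^ 2 + x 1 ^ 2 = ‖x‖ ^ 2 := fun x => by
    rw [EuclideanSpace.norm_sq_eq, Fin.sum_univ_two]; simp
  have hvi : ∀ i : Fin 2, ContDiff ℝ 2 (fun z : R2 => v (Lm z) i) := fun i =>
    (EuclideanSpace.proj i : V2 →L[ℝ] ℝ).contDiff.comp
      (hv.comp Lm.contDiff)
  obtain ⟨h1, h2⟩ := h
  have hc : ∀ (i : Fin 2) (z : R2),
      v (Lm z) 0 * pdv 0 v (Lm z) i + v (Lm z) 1 * pdv 1 v (Lm z) i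
        + fderiv ℝ p (Lm z) (EuclideanSpace.single i 1) = 0 := by
    intro i z
    have := congrArg (fun w : V2 => w i) (h1 (Lm z))
    simpa [grad_coord] using this
  have F : EFlow (fun z => v (Lm z) 0) (fun z => v (Lm z) 1) (fun z => p (Lm z)) (η ^ 2) (C ^ 2) :=
    { ha := hvi 0
      hb := hvi 1
      hp := hp.comp Lm.contDiff
      e1 := fun z => by
        have := hc 0 z
        simp only [dx, dy, fderiv_coord hv, fderiv_p hp, Lm_10, Lm_01]
        simp only [pdv] at this
        linarith
      e2 := fun z => by
        have := hc 1 z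
        simp only [dx, dy, fderiv_coord hv, fderiv_p hp, Lm_10, Lm_01]
        simp only [pdv] at this
        linarith
      dv := fun z => by
        have := h2 (Lm z)
        simp only [dx, dy, fderiv_coord hv, Lm_10, Lm_01]
        exact this
      mpos := by positivity
      lo := fun z => by
        rw [nsq]; exact pow_le_pow_left₀ hη.le (hlow _) 2
      hi := fun z => by
        rw [nsq]; exact pow_le_pow_left₀ (norm_nonneg _) (hb _) 2 }
  obtain ⟨e1, e2, he, V, hV, hpos, hsh⟩ := shear_R2 F
  have hsq := nsq (Lm (e1, e2))
  rw [Lm_zero, Lm_one] at hsq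
  refine ⟨Lm (e1, e2), ?_, V, hV, Or.inl hpos, fun x => ?_⟩
  · have h3 : ‖Lm (e1, e2)‖ ^ 2 = 1 := by rw [← hsq]; exact he
    exact (pow_eq_one_iff_of_nonneg (norm_nonneg _) two_ne_zero).1 h3
  · have hx : Lm (x 0, x 1) = x := by
      ext i; fin_cases i
      · exact Lm_zero _
      · exact Lm_one _
    have := hsh (x 0, x 1)
    simp only [hx] at this
    rw [Lm_zero, Lm_one]
    ext i; fin_cases i
    · simpa [Lm_zero] using this.1
    · simpa [Lm_one] using this.2
end
end
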